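/- Let d ≥ 1, 2 ≤ p ≤ ∞ and α, β > 0. There exists a constant C such that ‖f‖_p ‖f̂‖_{p′} ≤ C ‖ |x|^α f ‖_p ‖ |ξ|^β f̂ ‖_{p′} for all Schwartz functions f on ℝ^d if and only if α = β > d(1/2 − 1/p). -/

import Mathlib

open MeasureTheory
open scoped ENNReal FourierTransform

section HausdorffYoung

variable {V : Type*} [NormedAddCommGroup V] [InnerProductSpace ℝ V] [FiniteDimensional ℝ V]
  [MeasurableSpace V] [BorelSpace V]

theorem fourier_ae_eq_Lp_fourier {g : V → ℂ} (h1 : Integrable g) (h2 : MemLp g 2) :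
    𝓕 g =ᵐ[volume] (𝓕 (h2.toLp g) : Lp ℂ 2 (volume : Measure V)) := by
  set F2 : Lp ℂ 2 (volume : Measure V) := 𝓕 (h2.toLp g) with hF2
  have hcont : Continuous (𝓕 g) :=
    VectorFourier.fourierIntegral_continuous Real.continuous_fourierChar
      (by exact continuous_inner) h1
  have hloc : LocallyIntegrable (fun x => 𝓕 g x - F2 x) (volume : Measure V) :=
    hcont.locallyIntegrable.sub ((Lp.memLp F2).locallyIntegrable (by norm_num))
  have := ae_eq_zero_of_integral_contDiff_smul_eq_zero hloc ?_
  · filter_upwards [this] with x hx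
    exact sub_eq_zero.1 hx
  intro φ hφ hc
  have hg₁ : HasCompactSupport (Complex.ofRealCLM ∘ φ) := hc.comp_left rfl
  have hg₂ : ContDiff ℝ (⊤ : ℕ∞) (Complex.ofRealCLM ∘ φ) := by fun_prop
  set Φ : SchwartzMap V ℂ := hg₁.toSchwartzMap hg₂ with hΦ
  have hΦx : ∀ x, Φ x = (φ x : ℂ) := fun x => rfl
  have e1 := congrArg (fun T => T Φ) (Lp.fourier_toTemperedDistribution_eq (h2.toLp g))
  simp only [TemperedDistribution.fourier_apply, Lp.toTemperedDistribution_apply] at e1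
  have e2 : ∫ x, (𝓕 Φ) x • (h2.toLp g : V → ℂ) x = ∫ x, (𝓕 Φ) x • g x :=
    integral_congr_ae (by filter_upwards [h2.coeFn_toLp] with x hx; rw [hx])
  have e3 : ∫ x, (𝓕 Φ) x • g x = ∫ x, Φ x • 𝓕 g x := by
    have := VectorFourier.integral_fourierIntegral_smul_eq_flip (μ := volume) (ν := volume)
      (L := innerₗ V) Real.continuous_fourierChar continuous_inner (Φ.integrable (μ := volume)) h1
    rw [flip_innerₗ] at this
    exact this
  have i1 : Integrable (fun x => φ x • 𝓕 g x) :=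
    hcont.locallyIntegrable.integrable_smul_left_of_hasCompactSupport hφ.continuous hc
  have i2 : Integrable (fun x => φ x • F2 x) :=
    ((Lp.memLp F2).locallyIntegrable (by norm_num)).integrable_smul_left_of_hasCompactSupport
      hφ.continuous hc
  simp only [smul_sub]
  rw [integral_sub i1 i2, sub_eq_zero]
  have e4 : ∀ x, φ x • 𝓕 g x = Φ x • 𝓕 g x := fun x => by simp [hΦx]
  have e5 : ∀ x, φ x • F2 x = Φ x • F2 x := fun x => by simp [hΦx]
  simp_rw [e4, e5]
  rw [← e3, ← e2, e1]

theorem eLpNorm_fourier_two {g : V → ℂ} (h1 : Integrable g) (h2 : MemLp g 2) :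
    eLpNorm (𝓕 g) 2 volume = eLpNorm g 2 volume := by
  rw [eLpNorm_congr_ae (fourier_ae_eq_Lp_fourier h1 h2)]
  have := Lp.norm_fourier_eq (h2.toLp g)
  rw [← eLpNorm_congr_ae h2.coeFn_toLp, ← Lp.enorm_def, ← Lp.enorm_def, ← ofReal_norm,
    ← ofReal_norm, this]

theorem fourier_add_of_integrable {g h : V → ℂ} (hg : Integrable g) (hh : Integrable h) (x : V) :
    𝓕 (g + h) x = 𝓕 g x + 𝓕 h x := by
  have := VectorFourier.fourierIntegral_add (V := V) (W := V) (μ := (volume : Measure V))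
    (L := innerₗ V) Real.continuous_fourierChar continuous_inner hg hh
  exact congrFun this x

theorem enorm_fourier_le_lintegral (g : V → ℂ) (x : V) : ‖𝓕 g x‖ₑ ≤ ∫⁻ v, ‖g v‖ₑ := by
  rw [Real.fourier_eq]
  refine (enorm_integral_le_lintegral_enorm _).trans_eq ?_
  refine lintegral_congr fun v => ?_
  rw [← ofReal_norm, Circle.norm_smul, ofReal_norm]

theorem lintegral_fourier_sq {g : V → ℂ} (h1 : Integrable g) (h2 : MemLp g 2) :
    ∫⁻ x, ‖𝓕 g x‖ₑ ^ (2 : ℝ) = ∫⁻ x, ‖g x‖ₑ ^ (2 : ℝ) := by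
  have := eLpNorm_fourier_two h1 h2
  rw [eLpNorm_eq_lintegral_rpow_enorm_toReal (by norm_num) (by norm_num),
    eLpNorm_eq_lintegral_rpow_enorm_toReal (by norm_num) (by norm_num)] at this
  simpa using ENNReal.rpow_left_injective (by norm_num) this

theorem memLp_two_of_integrable_of_bound {g : V → ℂ} (h1 : Integrable g) {c : ℝ}
    (hc : ∀ x, ‖g x‖ ≤ c) : MemLp g 2 := by
  rw [memLp_two_iff_integrable_sq_norm h1.1]
  refine (h1.norm.const_mul c).mono' (h1.1.norm.pow 2) (ae_of_all _ fun x => ?_)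
  rw [Real.norm_of_nonneg (by positivity), sq]
  exact mul_le_mul_of_nonneg_right (hc x) (norm_nonneg _)

theorem continuous_fourier_of_integrable {g : V → ℂ} (h1 : Integrable g) : Continuous (𝓕 g) :=
  VectorFourier.fourierIntegral_continuous Real.continuous_fourierChar
    (by exact continuous_inner) h1

/-- The truncation used in the Marcinkiewicz-type proof of the Hausdorff–Young inequality. -/
theorem volume_le_norm_fourier_le {G : V → ℂ} (hG : Measurable G) (hi : Integrable G) {q l h : ℝ}
    (hq : 1 < q) (hl : 0 < l) (hh : 0 < h)
    (hlh : ENNReal.ofReal (h ^ (1 - q)) * ∫⁻ x, ‖G x‖ₑ ^ q ≤ ENNReal.ofReal (l / 2)) :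
    volume {x | l ≤ ‖𝓕 G x‖} ≤ ENNReal.ofReal (4 * l ^ (-2 : ℝ)) *
      ∫⁻ x, {x | ‖G x‖ ≤ h}.indicator (fun x => ‖G x‖ₑ ^ (2 : ℝ)) x := by
  set S : Set V := {x | ‖G x‖ ≤ h} with hS
  have hSm : MeasurableSet S := measurableSet_le hG.norm measurable_const
  have i1 : Integrable (S.indicator G) := hi.indicator hSm
  have i2 : Integrable (Sᶜ.indicator G) := hi.indicator hSm.compl
  have m2 : MemLp (S.indicator G) 2 := by
    refine memLp_two_of_integrable_of_bound i1 (c := h) fun x => ?_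
    by_cases hx : x ∈ S
    · rw [Set.indicator_of_mem hx]; exact hx
    · simp [hx, hh.le]
  have hhi : ∀ x, ‖𝓕 (Sᶜ.indicator G) x‖ ≤ l / 2 := by
    intro x
    rw [← ENNReal.ofReal_le_ofReal_iff (by positivity), ofReal_norm]
    refine (enorm_fourier_le_lintegral _ x).trans (le_trans ?_ hlh)
    rw [← lintegral_const_mul _ (hG.enorm.pow_const q)]
    refine lintegral_mono fun v => ?_
    by_cases hv : v ∈ S
    · simp [hv]
    · rw [Set.indicator_of_mem (by exact hv)]
      have hv' : h < ‖G v‖ := not_le.1 hv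
      have h0 : 0 < ‖G v‖ := hh.trans hv'
      rw [← ofReal_norm, ENNReal.ofReal_rpow_of_pos h0, ← ENNReal.ofReal_mul (by positivity)]
      refine ENNReal.ofReal_le_ofReal ?_
      calc ‖G v‖ = ‖G v‖ ^ (1 - q) * ‖G v‖ ^ q := by
            rw [← Real.rpow_add h0]; simp
        _ ≤ h ^ (1 - q) * ‖G v‖ ^ q := by
            gcongr ?_ * _
            exact Real.rpow_le_rpow_of_nonpos hh hv'.le (by linarith)
  have hsub : {x | l ≤ ‖𝓕 G x‖} ⊆
      {x | ENNReal.ofReal ((l / 2) ^ (2 : ℝ)) ≤ ‖𝓕 (S.indicator G) x‖ₑ ^ (2 : ℝ)} := by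
    intro x hx
    have hx : l ≤ ‖𝓕 G x‖ := hx
    have e : G = S.indicator G + Sᶜ.indicator G := (Set.indicator_self_add_compl S G).symm
    have e2 : 𝓕 G x = 𝓕 (S.indicator G) x + 𝓕 (Sᶜ.indicator G) x := by
      rw [← fourier_add_of_integrable i1 i2, ← e]
    have h3 : l / 2 ≤ ‖𝓕 (S.indicator G) x‖ := by
      have := norm_add_le (𝓕 (S.indicator G) x) (𝓕 (Sᶜ.indicator G) x)
      rw [← e2] at this
      linarith [hhi x]
    change ENNReal.ofReal ((l / 2) ^ (2 : ℝ)) ≤ ‖𝓕 (S.indicator G) x‖ₑ ^ (2 : ℝ)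
    rw [← ENNReal.ofReal_rpow_of_pos (by positivity), ← ofReal_norm]
    gcongr
  have hch := mul_meas_ge_le_lintegral₀ (μ := (volume : Measure V))
    (f := fun x => ‖𝓕 (S.indicator G) x‖ₑ ^ (2 : ℝ))
    ((continuous_fourier_of_integrable i1).measurable.enorm.pow_const 2).aemeasurable
    (ENNReal.ofReal ((l / 2) ^ (2 : ℝ)))
  rw [lintegral_fourier_sq i1 m2] at hch
  have e5 : ∀ x, ‖S.indicator G x‖ₑ ^ (2 : ℝ) = S.indicator (fun x => ‖G x‖ₑ ^ (2 : ℝ)) x := by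
    intro x
    by_cases hx : x ∈ S <;> simp [hx]
  simp_rw [e5] at hch
  calc volume {x | l ≤ ‖𝓕 G x‖} ≤ _ := measure_mono hsub
    _ = ENNReal.ofReal (4 * l ^ (-2 : ℝ)) * (ENNReal.ofReal ((l / 2) ^ (2 : ℝ)) * volume
      {x | ENNReal.ofReal ((l / 2) ^ (2 : ℝ)) ≤ ‖𝓕 (S.indicator G) x‖ₑ ^ (2 : ℝ)}) := by
        rw [← mul_assoc, ← ENNReal.ofReal_mul (by positivity)]
        have : 4 * l ^ (-2 : ℝ) * (l / 2) ^ (2 : ℝ) = 1 := by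
          rw [Real.rpow_neg hl.le]
          norm_num
          field_simp
          norm_num
        rw [this]; simp
    _ ≤ _ := by gcongr

theorem lintegral_Ioc_rpow {a L : ℝ} (ha : -1 < a) (hL : 0 ≤ L) :
    ∫⁻ l in Set.Ioc 0 L, ENNReal.ofReal (l ^ a) = ENNReal.ofReal (L ^ (a + 1) / (a + 1)) := by
  have hint : IntervalIntegrable (fun l : ℝ => l ^ a) volume 0 L :=
    intervalIntegral.intervalIntegrable_rpow' ha
  rw [← ofReal_integral_eq_lintegral_ofReal, ← intervalIntegral.integral_of_le hL,
    integral_rpow (Or.inl ha), Real.zero_rpow (by linarith), sub_zero]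
  · exact (intervalIntegrable_iff_integrableOn_Ioc_of_le hL).1 hint
  · filter_upwards [ae_restrict_mem measurableSet_Ioc] with l hl
    exact Real.rpow_nonneg hl.1.le _

theorem lintegral_fourier_rpow_le {p : ℝ} (hp : 2 < p) {G : V → ℂ} (hG : Measurable G)
    (hi : Integrable G) (hq0 : ∫⁻ x, ‖G x‖ₑ ^ (p / (p - 1)) ≠ 0)
    (hqt : ∫⁻ x, ‖G x‖ₑ ^ (p / (p - 1)) ≠ ∞) :
    ∫⁻ x, ‖𝓕 G x‖ₑ ^ p ≤ ENNReal.ofReal (p * (4 * 2 ^ (p - 2) / (p - 2))) *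
      (∫⁻ x, ‖G x‖ₑ ^ (p / (p - 1))) ^ (p - 1) := by
  set q : ℝ := p / (p - 1) with hq
  set m : ℝ≥0∞ := ∫⁻ x, ‖G x‖ₑ ^ q with hm
  set r : ℝ := m.toReal with hr
  have hr0 : 0 < r := ENNReal.toReal_pos hq0 hqt
  have hmr : m = ENNReal.ofReal r := (ENNReal.ofReal_toReal hqt).symm
  have hp1 : 0 < p - 1 := by linarith
  have hq1 : 1 < q := by rw [hq, lt_div_iff₀ hp1]; linarith
  have hexp : (p - 1) * (1 - q) = -1 := by rw [hq]; field_simp; ring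
  let H : ℝ → ℝ := fun l => (2 * r / l) ^ (p - 1)
  have step1 : ∀ l : ℝ, 0 < l → volume {x | l ≤ ‖𝓕 G x‖} * ENNReal.ofReal (l ^ (p - 1)) ≤
      ∫⁻ x, {y : ℝ × V | ‖G y.2‖ ≤ H y.1}.indicator
        (fun y => ENNReal.ofReal (4 * y.1 ^ (p - 3)) * ‖G y.2‖ₑ ^ (2 : ℝ)) (l, x) := by
    intro l hl
    have hH : 0 < H l := by positivity
    have := volume_le_norm_fourier_le hG hi hq1 hl hH (by
      rw [← hm, hmr, ← ENNReal.ofReal_mul (by positivity)]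
      refine ENNReal.ofReal_le_ofReal (le_of_eq ?_)
      rw [← Real.rpow_mul (by positivity), hexp, Real.rpow_neg_one]
      field_simp)
    calc _ ≤ _ := mul_le_mul_left this _
      _ = ENNReal.ofReal (4 * l ^ (p - 3)) *
          ∫⁻ x, {x | ‖G x‖ ≤ H l}.indicator (fun x => ‖G x‖ₑ ^ (2 : ℝ)) x := by
        rw [mul_right_comm, ← ENNReal.ofReal_mul (by positivity), mul_assoc,
          ← Real.rpow_add hl]
        congr 4; ring
      _ = _ := by
        rw [← lintegral_const_mul _ ((hG.enorm.pow_const 2).indicator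
          (measurableSet_le hG.norm measurable_const))]
        refine lintegral_congr fun x => ?_
        by_cases hx : ‖G x‖ ≤ H l <;> simp [hx]
  have hmeas : Measurable ({y : ℝ × V | ‖G y.2‖ ≤ H y.1}.indicator
        (fun y => ENNReal.ofReal (4 * y.1 ^ (p - 3)) * ‖G y.2‖ₑ ^ (2 : ℝ))) := by
    refine Measurable.indicator ?_ (measurableSet_le ?_ ?_)
    · fun_prop
    · fun_prop
    · exact ((measurable_const.div measurable_fst).pow_const _)
  have step2 : ∀ x : V, ∫⁻ l in Set.Ioi (0 : ℝ), {y : ℝ × V | ‖G y.2‖ ≤ H y.1}.indicator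
        (fun y => ENNReal.ofReal (4 * y.1 ^ (p - 3)) * ‖G y.2‖ₑ ^ (2 : ℝ)) (l, x) ≤
        ENNReal.ofReal (4 * (2 * r) ^ (p - 2) / (p - 2)) * ‖G x‖ₑ ^ q := by
    intro x
    rcases eq_or_ne (G x) 0 with h0 | h0
    · have : ∀ l : ℝ, {y : ℝ × V | ‖G y.2‖ ≤ H y.1}.indicator
        (fun y => ENNReal.ofReal (4 * y.1 ^ (p - 3)) * ‖G y.2‖ₑ ^ (2 : ℝ)) (l, x) = 0 := by
        intro l
        rw [Set.indicator_apply]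
        simp [h0]
      rw [lintegral_congr this, lintegral_zero]
      exact zero_le
    have hg : 0 < ‖G x‖ := norm_pos_iff.2 h0
    set L : ℝ := 2 * r * ‖G x‖ ^ (-(1 / (p - 1))) with hL
    have hL0 : 0 < L := by positivity
    have hle : ∀ l : ℝ, 0 < l → ‖G x‖ ≤ H l → l ≤ L := by
      intro l hl h
      have h2 : ‖G x‖ ^ (1 / (p - 1)) ≤ 2 * r / l := by
        have := Real.rpow_le_rpow hg.le h (z := 1 / (p - 1)) (by positivity)
        rwa [← Real.rpow_mul (by positivity), mul_one_div_cancel hp1.ne', Real.rpow_one] at this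
      rw [hL, Real.rpow_neg hg.le, ← div_eq_mul_inv, le_div_iff₀ (by positivity)]
      rw [le_div_iff₀ hl] at h2
      linarith
    calc _ ≤ ∫⁻ l in Set.Ioi (0 : ℝ), (Set.Ioc 0 L).indicator
          (fun l => ENNReal.ofReal (l ^ (p - 3)) * (ENNReal.ofReal 4 * ‖G x‖ₑ ^ (2 : ℝ))) l := by
          refine setLIntegral_mono' measurableSet_Ioi fun l hl => ?_
          have hl : 0 < l := hl
          by_cases h : ‖G x‖ ≤ H l
          · rw [Set.indicator_of_mem (by exact h),
              Set.indicator_of_mem (show l ∈ Set.Ioc 0 L from ⟨hl, hle l hl h⟩)]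
            dsimp only
            rw [ENNReal.ofReal_mul (by norm_num)]
            exact le_of_eq (by ring)
          · rw [Set.indicator_of_notMem (by exact h)]
            exact zero_le
      _ ≤ ∫⁻ l, (Set.Ioc 0 L).indicator
          (fun l => ENNReal.ofReal (l ^ (p - 3)) * (ENNReal.ofReal 4 * ‖G x‖ₑ ^ (2 : ℝ))) l :=
          setLIntegral_le_lintegral _ _
      _ = ENNReal.ofReal (L ^ (p - 2) / (p - 2)) * (ENNReal.ofReal 4 * ‖G x‖ₑ ^ (2 : ℝ)) := by
          rw [lintegral_indicator measurableSet_Ioc, lintegral_mul_const _ (by fun_prop),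
            lintegral_Ioc_rpow (by linarith) hL0.le, show p - 3 + 1 = p - 2 by ring]
      _ = _ := by
          rw [← ofReal_norm, ENNReal.ofReal_rpow_of_pos hg, ENNReal.ofReal_rpow_of_pos hg,
            ← ENNReal.ofReal_mul (by norm_num), ← ENNReal.ofReal_mul (by
              have : 0 < p - 2 := by linarith
              positivity), ← ENNReal.ofReal_mul (by
              have : 0 < p - 2 := by linarith
              positivity)]
          congr 1
          rw [hL, Real.mul_rpow (by positivity) (by positivity), ← Real.rpow_mul hg.le]
          have e : q = -(1 / (p - 1)) * (p - 2) + 2 := by rw [hq]; field_simp; ring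
          rw [e, Real.rpow_add hg]
          ring
  have e0 : ∀ x, ‖𝓕 G x‖ₑ ^ p = ENNReal.ofReal (‖𝓕 G x‖ ^ p) := fun x => by
    rw [← ofReal_norm, ENNReal.ofReal_rpow_of_nonneg (norm_nonneg _) (by linarith)]
  simp_rw [e0]
  rw [lintegral_rpow_eq_lintegral_meas_le_mul volume (ae_of_all _ fun x => norm_nonneg _)
    (continuous_fourier_of_integrable hi).norm.measurable.aemeasurable (by linarith)]
  rw [ENNReal.ofReal_mul (by linarith), mul_assoc]
  gcongr
  calc _ ≤ ∫⁻ l in Set.Ioi (0 : ℝ), ∫⁻ x, {y : ℝ × V | ‖G y.2‖ ≤ H y.1}.indicator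
        (fun y => ENNReal.ofReal (4 * y.1 ^ (p - 3)) * ‖G y.2‖ₑ ^ (2 : ℝ)) (l, x) :=
        setLIntegral_mono' measurableSet_Ioi fun l hl => step1 l hl
    _ = ∫⁻ x, ∫⁻ l in Set.Ioi (0 : ℝ), {y : ℝ × V | ‖G y.2‖ ≤ H y.1}.indicator
        (fun y => ENNReal.ofReal (4 * y.1 ^ (p - 3)) * ‖G y.2‖ₑ ^ (2 : ℝ)) (l, x) :=
        lintegral_lintegral_swap hmeas.aemeasurable
    _ ≤ ∫⁻ x, ENNReal.ofReal (4 * (2 * r) ^ (p - 2) / (p - 2)) * ‖G x‖ₑ ^ q :=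
        lintegral_mono step2
    _ = _ := by
        have hp2 : 0 < p - 2 := by linarith
        rw [lintegral_const_mul _ (hG.enorm.pow_const _), ← hm, hmr,
          ENNReal.ofReal_rpow_of_pos hr0, ← ENNReal.ofReal_mul (by positivity),
          ← ENNReal.ofReal_mul (by positivity)]
        congr 1
        have e : p - 1 = (p - 2) + 1 := by ring
        rw [e, Real.rpow_add hr0, Real.rpow_one, Real.mul_rpow (by norm_num) hr0.le]
        ring

theorem exists_eLpNorm_fourier_le {p p' : ℝ≥0∞} (hp : 2 ≤ p) (hconj : 1 / p + 1 / p' = 1) :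
    ∃ C : ℝ, 0 < C ∧ ∀ G : V → ℂ, Measurable G → Integrable G → MemLp G 2 →
      eLpNorm (𝓕 G) p volume ≤ ENNReal.ofReal C * eLpNorm G p' volume := by
  simp only [one_div] at hconj
  rcases eq_or_ne p ∞ with rfl | hptop
  · have hp' : p' = 1 := by simpa using hconj
    subst hp'
    refine ⟨1, one_pos, fun G _ _ _ => ?_⟩
    rw [ENNReal.ofReal_one, one_mul, eLpNorm_one_eq_lintegral_enorm, eLpNorm_exponent_top]
    exact eLpNormEssSup_le_of_ae_enorm_bound (ae_of_all _ (enorm_fourier_le_lintegral G))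
  rcases hp.eq_or_lt with rfl | hp2
  · have hp' : p' = 2 := by
      have h : p'⁻¹ = 2⁻¹ := by
        refine (ENNReal.add_right_inj (a := 2⁻¹) (by simp)).1 ?_
        rw [hconj, ENNReal.inv_two_add_inv_two]
      simpa using h
    subst hp'
    refine ⟨1, one_pos, fun G _ h1 h2 => ?_⟩
    rw [ENNReal.ofReal_one, one_mul, eLpNorm_fourier_two h1 h2]
  have hp0 : p ≠ 0 := (zero_lt_two.trans hp2).ne'
  set r := p.toReal with hr
  have hr2 : 2 < r := by
    rw [hr, ← ENNReal.toReal_ofNat]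
    exact (ENNReal.toReal_lt_toReal (by simp) hptop).2 hp2
  have hH : p.HolderConjugate p' := ENNReal.holderConjugate_iff.2 hconj
  have hreal : p'⁻¹.toReal = 1 - r⁻¹ := by
    have h := congrArg ENNReal.toReal hconj
    rw [ENNReal.toReal_add (by simpa using hp0)] at h
    · rw [ENNReal.toReal_inv p] at h
      simp only [ENNReal.toReal_one] at h
      rw [← hr] at h
      linarith
    · intro h0
      rw [h0] at hconj
      simp at hconj
  have hp'r : p'.toReal = r / (r - 1) := by
    rw [ENNReal.toReal_inv] at hreal
    rw [← inv_inv p'.toReal, hreal]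
    field_simp
  have hp'0 : p' ≠ 0 := by
    rintro rfl
    simp at hconj
  have hp'top : p' ≠ ∞ := by
    rintro rfl
    simp only [ENNReal.toReal_top] at hp'r
    have : 0 < r / (r - 1) := div_pos (by linarith) (by linarith)
    linarith
  set c : ℝ := r * (4 * 2 ^ (r - 2) / (r - 2)) with hc
  have hcpos : 0 < c := by
    have : 0 < r - 2 := by linarith
    positivity
  refine ⟨c ^ (1 / r), by positivity, fun G hG h1 h2 => ?_⟩
  rw [eLpNorm_eq_lintegral_rpow_enorm_toReal hp0 hptop,
    eLpNorm_eq_lintegral_rpow_enorm_toReal hp'0 hp'top, hp'r, ← hr]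
  set I := ∫⁻ x, ‖G x‖ₑ ^ (r / (r - 1)) with hI
  have hrr : 0 < r / (r - 1) := div_pos (by linarith) (by linarith)
  by_cases hI0 : I = 0
  · have hG0 : G =ᵐ[volume] 0 := by
      rw [hI, lintegral_eq_zero_iff (by fun_prop)] at hI0
      filter_upwards [hI0] with x hx
      simpa [hrr, hrr.not_gt, hrr.le, hrr.not_ge] using hx
    have hF : ∀ x, ‖𝓕 G x‖ₑ = 0 := fun x => by
      refine le_antisymm ((enorm_fourier_le_lintegral G x).trans ?_) zero_le
      rw [lintegral_congr_ae (g := fun _ => 0)]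
      · simp
      · filter_upwards [hG0] with y hy
        simp [hy]
    simp only [hF, ENNReal.zero_rpow_of_pos (show (0:ℝ) < r by linarith), lintegral_const, zero_mul]
    rw [ENNReal.zero_rpow_of_pos (by positivity)]
    exact zero_le
  by_cases hIt : I = ∞
  · rw [hIt, ENNReal.top_rpow_of_pos (by positivity), ENNReal.mul_top]
    · exact le_top
    · simp only [ne_eq, ENNReal.ofReal_eq_zero, not_le]
      positivity
  calc (∫⁻ x, ‖𝓕 G x‖ₑ ^ r) ^ (1 / r) ≤ (ENNReal.ofReal c * I ^ (r - 1)) ^ (1 / r) := by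
        gcongr
        exact lintegral_fourier_rpow_le hr2 hG h1 hI0 hIt
    _ = _ := by
        rw [ENNReal.mul_rpow_of_nonneg _ _ (by positivity),
          ENNReal.ofReal_rpow_of_nonneg hcpos.le (by positivity), ← ENNReal.rpow_mul]
        congr 2
        have : r - 1 ≠ 0 := by linarith
        field_simp

theorem eLpNorm_comp_smul {E : Type*} [NormedAddCommGroup E] (F : V → E) (p : ℝ≥0∞) {c : ℝ}
    (hc : 0 < c) :
    eLpNorm (fun x => F (c • x)) p volume =
      ENNReal.ofReal (c ^ (-(Module.finrank ℝ V * (1 / p).toReal))) * eLpNorm F p volume := by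
  have hemb : MeasurableEmbedding (fun x : V => c • x) :=
    (Homeomorph.smulOfNeZero c hc.ne').measurableEmbedding
  have h1 := hemb.eLpNorm_map_measure (p := p) (g := F) (μ := (volume : Measure V))
  rw [show (fun x => F (c • x)) = F ∘ (fun x => c • x) from rfl, ← h1,
    Measure.map_addHaar_smul _ hc.ne', eLpNorm_smul_measure_of_ne_zero, smul_eq_mul,
    ENNReal.ofReal_rpow_of_nonneg (by positivity) (by positivity), abs_of_pos (by positivity)]
  · congr 2
    rw [← Real.rpow_natCast, ← Real.rpow_neg hc.le, ← Real.rpow_mul hc.le]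
    ring_nf
  · simp only [ne_eq, ENNReal.ofReal_eq_zero, not_le]
    positivity

theorem exists_eLpNorm_le_eLpNorm_fourier {p p' : ℝ≥0∞} (hp : 2 ≤ p) (hconj : 1 / p + 1 / p' = 1) :
    ∃ C : ℝ, 0 < C ∧ ∀ f : SchwartzMap V ℂ,
      eLpNorm f p volume ≤ ENNReal.ofReal C * eLpNorm (𝓕 (f : V → ℂ)) p' volume := by
  obtain ⟨C, hC, h⟩ := exists_eLpNorm_fourier_le (V := V) hp hconj
  refine ⟨C, hC, fun f => ?_⟩
  set g : SchwartzMap V ℂ := 𝓕 f with hg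
  have h1 : 𝓕 (f : V → ℂ) = g := (SchwartzMap.fourier_coe f).symm
  have h2 := h g g.continuous.measurable g.integrable (g.memLp 2 volume)
  have h3 : (f : V → ℂ) = (𝓕 (g : V → ℂ)) ∘ Neg.neg := by
    have h4 : 𝓕⁻ g = f := FourierTransform.fourierInv_fourier_eq f
    ext x
    rw [← h4, SchwartzMap.fourierInv_coe, Real.fourierInv_eq_fourier_neg]
    rfl
  have h5 : AEStronglyMeasurable (𝓕 (g : V → ℂ)) (volume : Measure V) :=
    (continuous_fourier_of_integrable g.integrable).aestronglyMeasurable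
  rw [h1, h3, eLpNorm_comp_measurePreserving h5 (Measure.measurePreserving_neg volume)]
  exact h2

end HausdorffYoung

section Sufficiency

variable {V : Type*} [NormedAddCommGroup V] [InnerProductSpace ℝ V] [FiniteDimensional ℝ V]
  [MeasurableSpace V] [BorelSpace V]

theorem exists_eLpNorm_indicator_norm_rpow_le {q : ℝ≥0∞} {α : ℝ} (hα : 0 < α)
    (hq : Module.finrank ℝ V * (1 / q).toReal < α) (hq0 : q ≠ 0) :
    ∃ κ : ℝ, 0 ≤ κ ∧ ∀ r : ℝ, 0 < r →
      eLpNorm ({x : V | r < ‖x‖}.indicator fun x => ‖x‖ ^ (-α)) q volume ≤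
        ENNReal.ofReal (κ * r ^ (Module.finrank ℝ V * (1 / q).toReal - α)) := by
  set W : V → ℝ := {x : V | 1 < ‖x‖}.indicator fun x => ‖x‖ ^ (-α) with hW
  have hfin : eLpNorm W q volume < ∞ := by
    rcases eq_or_ne q ∞ with rfl | hqt
    · rw [eLpNorm_exponent_top]
      refine (eLpNormEssSup_le_of_ae_enorm_bound (C := 1) (ae_of_all _ fun x => ?_)).trans_lt
        ENNReal.one_lt_top
      rw [hW]
      by_cases hx : x ∈ {x : V | 1 < ‖x‖}
      · rw [Set.indicator_of_mem hx, Real.enorm_of_nonneg (by positivity)]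
        exact ENNReal.ofReal_le_one.2 (Real.rpow_le_one_of_one_le_of_nonpos (le_of_lt hx)
          (by linarith))
      · simp [Set.indicator_of_notMem hx]
    · rw [eLpNorm_lt_top_iff_lintegral_rpow_enorm_lt_top hq0 hqt]
      have hqr : 0 < q.toReal := ENNReal.toReal_pos hq0 hqt
      have hn : (Module.finrank ℝ V : ℝ) < α * q.toReal := by
        rw [one_div, ENNReal.toReal_inv, ← div_eq_mul_inv, div_lt_iff₀ hqr] at hq
        exact hq
      have hI := finite_integral_one_add_norm (μ := (volume : Measure V)) hn
      refine (lintegral_mono (g := fun x => ENNReal.ofReal (2 ^ (α * q.toReal)) *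
        ENNReal.ofReal ((1 + ‖x‖) ^ (-(α * q.toReal)))) fun x => ?_).trans_lt ?_
      · beta_reduce
        rw [hW]
        by_cases hx : x ∈ {x : V | 1 < ‖x‖}
        · have hx1 : 1 < ‖x‖ := hx
          rw [Set.indicator_of_mem hx, Real.enorm_of_nonneg (by positivity),
            ENNReal.ofReal_rpow_of_nonneg (by positivity) hqr.le,
            ← ENNReal.ofReal_mul (by positivity)]
          refine ENNReal.ofReal_le_ofReal ?_
          have h2 : (2:ℝ) ^ (α * q.toReal) * (1 + ‖x‖) ^ (-(α * q.toReal)) =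
              ((1 + ‖x‖) / 2) ^ (-(α * q.toReal)) := by
            rw [Real.div_rpow (by positivity) (by positivity),
              Real.rpow_neg (by norm_num : (0:ℝ) ≤ 2),
              div_inv_eq_mul, mul_comm]
          rw [h2, ← Real.rpow_mul (by positivity), neg_mul]
          exact Real.rpow_le_rpow_of_nonpos (by positivity) (by linarith)
            (by rw [neg_nonpos]; positivity)
        · simp [Set.indicator_of_notMem hx, ENNReal.zero_rpow_of_pos hqr]
      · rw [lintegral_const_mul' _ _ ENNReal.ofReal_ne_top]
        exact ENNReal.mul_lt_top ENNReal.ofReal_lt_top hI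
  refine ⟨(eLpNorm W q volume).toReal, ENNReal.toReal_nonneg, fun r hr => ?_⟩
  have hWr : ({x : V | r < ‖x‖}.indicator fun x => ‖x‖ ^ (-α)) =
      (r ^ (-α)) • fun x => W (r⁻¹ • x) := by
    ext x
    have hmem : r⁻¹ • x ∈ {x : V | 1 < ‖x‖} ↔ x ∈ {x : V | r < ‖x‖} := by
      simp only [Set.mem_ofPred_eq, norm_smul, norm_inv, Real.norm_of_nonneg hr.le]
      rw [inv_mul_eq_div, one_lt_div hr]
    by_cases hx : x ∈ {x : V | r < ‖x‖}
    · rw [Set.indicator_of_mem hx]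
      simp only [Pi.smul_apply, smul_eq_mul]
      rw [hW, Set.indicator_of_mem (hmem.2 hx), norm_smul, norm_inv, Real.norm_of_nonneg hr.le,
        Real.mul_rpow (by positivity) (by positivity), Real.inv_rpow hr.le, ← mul_assoc,
        mul_inv_cancel₀ (by positivity), one_mul]
    · rw [Set.indicator_of_notMem hx]
      simp only [Pi.smul_apply, smul_eq_mul]
      rw [hW, Set.indicator_of_notMem (fun h => hx (hmem.1 h)), mul_zero]
  rw [hWr, eLpNorm_const_smul, eLpNorm_comp_smul W q (inv_pos.2 hr),
    Real.enorm_of_nonneg (by positivity), mul_comm (eLpNorm W q volume).toReal,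
    ENNReal.ofReal_mul (by positivity), ENNReal.ofReal_toReal hfin.ne, ← mul_assoc,
    ← ENNReal.ofReal_mul (by positivity)]
  refine le_of_eq ?_
  congr 2
  rw [Real.inv_rpow hr.le, ← Real.rpow_neg hr.le, ← Real.rpow_add hr]
  ring_nf

theorem toReal_one_div_conj {p p' : ℝ≥0∞} (hp : 2 ≤ p) (hconj : 1 / p + 1 / p' = 1) :
    (1 / p').toReal = 1 - (1 / p).toReal := by
  have h := congrArg ENNReal.toReal hconj
  have hp0 : p ≠ 0 := (zero_lt_two.trans_le hp).ne'
  rw [ENNReal.toReal_add (by simpa using hp0), ENNReal.toReal_one] at h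
  · linarith
  · intro h0
    rw [h0] at hconj
    simp at hconj

theorem toReal_one_div_mem {p : ℝ≥0∞} (hp : 2 ≤ p) : (1 / p).toReal ∈ Set.Icc 0 (1 / 2 : ℝ) := by
  refine ⟨ENNReal.toReal_nonneg, ?_⟩
  have h : (1 / p) ≤ 1 / 2 := by gcongr
  simpa using ENNReal.toReal_mono (by simp) h

theorem one_le_conj_le_two {p p' : ℝ≥0∞} (hp : 2 ≤ p) (hconj : 1 / p + 1 / p' = 1) :
    1 ≤ p' ∧ p' ≤ 2 := by
  simp only [one_div] at hconj
  constructor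
  · rw [← ENNReal.inv_le_inv, inv_one, ← hconj]
    exact le_add_self
  · rw [← ENNReal.inv_le_inv]
    have h1 : p⁻¹ ≤ 2⁻¹ := ENNReal.inv_le_inv.2 hp
    by_contra! hlt
    have h2 : p⁻¹ + p'⁻¹ < 2⁻¹ + 2⁻¹ := ENNReal.add_lt_add_of_le_of_lt
      (ne_top_of_le_ne_top (by simp) h1) h1 hlt
    rw [hconj, ENNReal.inv_two_add_inv_two] at h2
    exact lt_irrefl _ h2

theorem eLpNorm_fourier_le_of_split {p p' q : ℝ≥0∞} (hp : 2 ≤ p) (hconj : 1 / p + 1 / p' = 1)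
    (hq : q⁻¹ + p⁻¹ = 2⁻¹) {α : ℝ} (hα : 0 < α) (f : SchwartzMap V ℂ) {r R : ℝ} (hr : 0 < r)
    (hR : 0 < R) :
    eLpNorm (𝓕 (f : V → ℂ)) p' volume ≤
      ENNReal.ofReal (R ^ (-α)) * eLpNorm (fun ξ => ‖ξ‖ ^ α * ‖𝓕 (f : V → ℂ) ξ‖) p' volume +
      (volume (Metric.closedBall (0 : V) R)) ^ (1 / 2 - (1 / p).toReal) *
        (volume (Metric.closedBall (0 : V) R) ^ (1 / 2 : ℝ) *
          (volume (Metric.closedBall (0 : V) r) ^ (1 - (1 / p).toReal) * eLpNorm f p volume) +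
        eLpNorm ({x : V | r < ‖x‖}.indicator fun x => ‖x‖ ^ (-α)) q volume *
          eLpNorm (fun x => ‖x‖ ^ α * ‖f x‖) p volume) := by
  have hpp := toReal_one_div_conj hp hconj
  obtain ⟨hp'1, hp'2⟩ := one_le_conj_le_two hp hconj
  set S := Metric.closedBall (0 : V) R with hS
  set T := Metric.closedBall (0 : V) r with hT
  have hSm : MeasurableSet S := Metric.isClosed_closedBall.measurableSet
  have hTm : MeasurableSet T := Metric.isClosed_closedBall.measurableSet
  have hfi : Integrable (f : V → ℂ) := f.integrable
  have hf2 : MemLp (f : V → ℂ) 2 volume := f.memLp 2 volume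
  set g : V → ℂ := 𝓕 (f : V → ℂ) with hg
  have hgm : AEStronglyMeasurable g (volume : Measure V) :=
    (continuous_fourier_of_integrable hfi).aestronglyMeasurable
  have hfar : eLpNorm (Sᶜ.indicator g) p' volume ≤
      ENNReal.ofReal (R ^ (-α)) * eLpNorm (fun ξ => ‖ξ‖ ^ α * ‖g ξ‖) p' volume := by
    rw [← Real.enorm_of_nonneg (show 0 ≤ R ^ (-α) by positivity), ← eLpNorm_const_smul]
    refine eLpNorm_mono fun ξ => ?_
    by_cases hξ : ξ ∈ S
    · simp only [Set.indicator_of_notMem (show ξ ∉ Sᶜ by simpa using hξ), norm_zero]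
      positivity
    · rw [Set.indicator_of_mem (by exact hξ), Pi.smul_apply, smul_eq_mul,
        Real.norm_of_nonneg (by positivity), ← mul_assoc]
      refine le_mul_of_one_le_left (norm_nonneg _) ?_
      have hRξ : R ≤ ‖ξ‖ := by
        rw [hS, mem_closedBall_zero_iff, not_le] at hξ
        exact hξ.le
      rw [Real.rpow_neg hR.le, inv_mul_eq_div, one_le_div (by positivity)]
      gcongr
  have hnear : eLpNorm (S.indicator g) p' volume ≤
      eLpNorm g 2 (volume.restrict S) * volume S ^ (1 / 2 - (1 / p).toReal) := by
    rw [eLpNorm_indicator_eq_eLpNorm_restrict hSm]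
    refine (eLpNorm_le_eLpNorm_mul_rpow_measure_univ hp'2 hgm.restrict).trans_eq ?_
    rw [Measure.restrict_apply_univ]
    congr 2
    rw [one_div p', ENNReal.toReal_inv] at hpp
    rw [one_div, hpp]
    simp only [ENNReal.toReal_ofNat]
    ring
  have hf1i : Integrable (T.indicator (f : V → ℂ)) := hfi.indicator hTm
  have hf2i : Integrable (Tᶜ.indicator (f : V → ℂ)) := hfi.indicator hTm.compl
  have hgsplit : g = 𝓕 (T.indicator (f : V → ℂ)) + 𝓕 (Tᶜ.indicator (f : V → ℂ)) := by
    ext x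
    rw [Pi.add_apply, ← fourier_add_of_integrable hf1i hf2i, Set.indicator_self_add_compl]
  have hlow : eLpNorm (𝓕 (T.indicator (f : V → ℂ))) 2 (volume.restrict S) ≤
      volume S ^ (1 / 2 : ℝ) * (volume T ^ (1 - (1 / p).toReal) * eLpNorm f p volume) := by
    refine (eLpNorm_le_of_ae_enorm_bound (ae_of_all _
      (enorm_fourier_le_lintegral (T.indicator (f : V → ℂ))))).trans ?_
    rw [smul_eq_mul, mul_comm, Measure.restrict_apply_univ, ← eLpNorm_one_eq_lintegral_enorm,
      eLpNorm_indicator_eq_eLpNorm_restrict hTm]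
    simp only [ENNReal.toReal_ofNat, one_div]
    gcongr
    refine (eLpNorm_le_eLpNorm_mul_rpow_measure_univ (one_le_two.trans hp)
      hfi.1.restrict).trans ?_
    rw [Measure.restrict_apply_univ, mul_comm]
    simp only [ENNReal.toReal_one, one_div, inv_one, ENNReal.toReal_inv]
    gcongr
    exact Measure.restrict_le_self
  have hhigh : eLpNorm (𝓕 (Tᶜ.indicator (f : V → ℂ))) 2 (volume.restrict S) ≤
      eLpNorm ({x : V | r < ‖x‖}.indicator fun x => ‖x‖ ^ (-α)) q volume *
          eLpNorm (fun x => ‖x‖ ^ α * ‖f x‖) p volume := by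
    refine (eLpNorm_mono_measure _ Measure.restrict_le_self).trans ?_
    rw [eLpNorm_fourier_two hf2i (hf2.indicator hTm.compl)]
    have : ENNReal.HolderTriple q p 2 := ⟨hq⟩
    refine le_trans (eLpNorm_mono fun x => ?_) (eLpNorm_smul_le_mul_eLpNorm (p := q) (q := p)
      (f := fun x : V => ‖x‖ ^ α * ‖f x‖) ?_ ?_)
    · by_cases hx : x ∈ T
      · simp only [Set.indicator_of_notMem (show x ∉ Tᶜ by simpa using hx), norm_zero]
        positivity
      · have hx' : x ∈ {x : V | r < ‖x‖} := by
          rw [hT, mem_closedBall_zero_iff, not_le] at hx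
          exact hx
        have hxp : 0 < ‖x‖ := hr.trans hx'
        rw [Set.indicator_of_mem (by exact hx), Pi.smul_apply', Set.indicator_of_mem hx',
          smul_eq_mul, Real.norm_of_nonneg (by positivity), ← mul_assoc, ← Real.rpow_add hxp]
        simp
    · exact (Measurable.aestronglyMeasurable (by fun_prop)).mul hfi.1.norm
    · refine (Measurable.aestronglyMeasurable (by fun_prop)).indicator ?_
      exact measurableSet_lt measurable_const measurable_norm
  calc eLpNorm g p' volume = eLpNorm (S.indicator g + Sᶜ.indicator g) p' volume := by
        rw [Set.indicator_self_add_compl]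
    _ ≤ eLpNorm (S.indicator g) p' volume + eLpNorm (Sᶜ.indicator g) p' volume :=
        eLpNorm_add_le (hgm.indicator hSm) (hgm.indicator hSm.compl) hp'1
    _ ≤ eLpNorm g 2 (volume.restrict S) * volume S ^ (1 / 2 - (1 / p).toReal) + _ :=
        add_le_add hnear hfar
    _ ≤ _ := by
        rw [add_comm, mul_comm (eLpNorm g 2 _)]
        gcongr
        conv_lhs => rw [hgsplit]
        refine (eLpNorm_add_le
          (continuous_fourier_of_integrable hf1i).aestronglyMeasurable
          (continuous_fourier_of_integrable hf2i).aestronglyMeasurable one_le_two).trans ?_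
        exact add_le_add hlow hhigh

theorem exists_mul_le_of_forall_scale {α γ s H c₁ c₂ : ℝ} (hα : 0 < α) (hγ : 0 ≤ γ) (hs : 0 < s)
    (hH : 0 < H) (hc₁ : 0 ≤ c₁) (hc₂ : 0 ≤ c₂) :
    ∃ C : ℝ, 0 < C ∧ ∀ M N A B : ℝ, 0 < M → 0 < N → 0 < A → 0 < B → N ≤ H * M →
      (∀ r R : ℝ, 0 < r → 0 < R → M ≤ R ^ (-α) * B +
        (c₁ * (R * r) ^ s * N + c₂ * (R * r) ^ γ * (r ^ (-α) * A))) →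
      N * M ≤ C * (A * B) := by
  set K : ℝ := 8 * c₂ * H + 1 with hK
  have hKpos : 0 < K := by positivity
  set ρ₀ : ℝ := min 1 ((8 * c₁ * H + 1)⁻¹ ^ s⁻¹) with hρ₀
  have hρ₀pos : 0 < ρ₀ := lt_min one_pos (by positivity)
  refine ⟨2 * K / ρ₀ ^ α, by positivity, fun M N A B hM hN hA hB hNM h => ?_⟩
  set r : ℝ := (K * A / N) ^ α⁻¹ with hr
  set R : ℝ := (2 * B / M) ^ α⁻¹ with hR
  have hrpos : 0 < r := by positivity
  have hRpos : 0 < R := by positivity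
  have hrα : r ^ α = K * A / N := Real.rpow_inv_rpow (by positivity) hα.ne'
  have hRα : R ^ α = 2 * B / M := Real.rpow_inv_rpow (by positivity) hα.ne'
  have hρ : (R * r) ^ α = 2 * K * (A * B) / (N * M) := by
    rw [Real.mul_rpow hRpos.le hrpos.le, hrα, hRα]
    field_simp
  rcases le_or_gt ρ₀ (R * r) with hle | hlt
  · have h1 : ρ₀ ^ α ≤ 2 * K * (A * B) / (N * M) := by
      rw [← hρ]
      gcongr
    rw [le_div_iff₀ (by positivity)] at h1
    rw [div_mul_eq_mul_div, le_div_iff₀ (by positivity)]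
    linarith
  · exfalso
    have h1 := h r R hrpos hRpos
    rw [Real.rpow_neg hRpos.le, Real.rpow_neg hrpos.le, hrα, hRα] at h1
    have e1 : (2 * B / M)⁻¹ * B = M / 2 := by field_simp
    have e2 : (K * A / N)⁻¹ * A = N / K := by field_simp
    rw [e1, e2] at h1
    have hρs : (R * r) ^ s ≤ (8 * c₁ * H + 1)⁻¹ := by
      calc (R * r) ^ s ≤ ((8 * c₁ * H + 1)⁻¹ ^ s⁻¹) ^ s := by
            gcongr
            exact hlt.le.trans (min_le_right _ _)
        _ = _ := Real.rpow_inv_rpow (by positivity) hs.ne'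
    have hργ : (R * r) ^ γ ≤ 1 :=
      Real.rpow_le_one (by positivity) (hlt.le.trans (min_le_left _ _)) hγ
    have h2 : c₁ * (R * r) ^ s * N ≤ M / 8 := by
      calc c₁ * (R * r) ^ s * N ≤ c₁ * (8 * c₁ * H + 1)⁻¹ * (H * M) := by gcongr
        _ ≤ M / 8 := by
          rw [← div_eq_mul_inv, div_mul_eq_mul_div, div_le_iff₀ (by positivity)]
          nlinarith
    have h3 : c₂ * (R * r) ^ γ * (N / K) ≤ M / 8 := by
      calc c₂ * (R * r) ^ γ * (N / K) ≤ c₂ * 1 * (H * M / K) := by gcongr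
        _ ≤ M / 8 := by
          rw [mul_one, ← mul_div_assoc, div_le_iff₀ hKpos, hK]
          nlinarith
    linarith

theorem eLpNorm_pos_of_continuous {E : Type*} [NormedAddCommGroup E] {F : V → E}
    (hF : Continuous F) {p : ℝ≥0∞} (hp : p ≠ 0) {x : V} (hx : F x ≠ 0) :
    0 < eLpNorm F p volume := by
  rw [pos_iff_ne_zero, ne_eq, eLpNorm_eq_zero_iff hF.aestronglyMeasurable hp]
  intro h
  exact hx (congrFun (Continuous.ae_eq_iff_eq volume hF continuous_const |>.1 h) x)

theorem eLpNorm_weight_pos {E : Type*} [NormedAddCommGroup E] {F : V → E}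
    (hF : Continuous F) {p : ℝ≥0∞} (hp : p ≠ 0) {α : ℝ} (hα : 0 < α) (hn : 0 < Module.finrank ℝ V)
    {x : V} (hx : F x ≠ 0) :
    0 < eLpNorm (fun x => ‖x‖ ^ α * ‖F x‖) p volume := by
  have : Nontrivial V := Module.finrank_pos_iff.1 hn
  have hcont : Continuous fun x : V => ‖x‖ ^ α * ‖F x‖ :=
    (continuous_norm.rpow_const fun _ => Or.inr hα.le).mul hF.norm
  rw [pos_iff_ne_zero, ne_eq, eLpNorm_eq_zero_iff hcont.aestronglyMeasurable hp]
  intro h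
  have hne : ∀ᵐ y : V, y ≠ 0 := by
    simp [ae_iff]
  have hF0 : F =ᵐ[volume] fun _ => 0 := by
    filter_upwards [h, hne] with y hy hy0
    have : 0 < ‖y‖ ^ α := Real.rpow_pos_of_pos (norm_pos_iff.2 hy0) _
    simpa [this.ne'] using hy
  exact hx (congrFun (Continuous.ae_eq_iff_eq volume hF continuous_const |>.1 hF0) x)

theorem heisenberg_of_lt {p p' : ℝ≥0∞} (hp : 2 ≤ p) (hconj : 1 / p + 1 / p' = 1) {α : ℝ}
    (hα : 0 < α) (hn : 0 < Module.finrank ℝ V)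
    (hlt : Module.finrank ℝ V * (1 / 2 - (1 / p).toReal) < α) :
    ∃ C : ℝ, 0 < C ∧ ∀ f : SchwartzMap V ℂ,
      eLpNorm f p volume * eLpNorm (𝓕 (f : V → ℂ)) p' volume ≤ ENNReal.ofReal C *
        (eLpNorm (fun x => ‖x‖ ^ α * ‖f x‖) p volume *
          eLpNorm (fun ξ => ‖ξ‖ ^ α * ‖𝓕 (f : V → ℂ) ξ‖) p' volume) := by
  obtain ⟨ha0, ha2⟩ := toReal_one_div_mem hp
  obtain ⟨hp'1, -⟩ := one_le_conj_le_two hp hconj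
  have hp0 : p ≠ 0 := (zero_lt_two.trans_le hp).ne'
  have hp'0 : p' ≠ 0 := (zero_lt_one.trans_le hp'1).ne'
  set a := (1 / p).toReal with ha
  set n := Module.finrank ℝ V with hndef
  have hnpos : (0 : ℝ) < n := by exact_mod_cast hn
  obtain ⟨H, hH, hHY⟩ := exists_eLpNorm_le_eLpNorm_fourier (V := V) hp hconj
  set q : ℝ≥0∞ := (2⁻¹ - p⁻¹)⁻¹ with hqdef
  have hpinv : p⁻¹ ≤ 2⁻¹ := ENNReal.inv_le_inv.2 hp
  have hq : q⁻¹ + p⁻¹ = 2⁻¹ := by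
    rw [hqdef, inv_inv, tsub_add_cancel_of_le hpinv]
  have hqr : (1 / q).toReal = 1 / 2 - a := by
    rw [one_div, hqdef, inv_inv, ENNReal.toReal_sub_of_le hpinv (by simp), ha, one_div]
    simp
  have hq0 : q ≠ 0 := by
    rw [hqdef, ne_eq, ENNReal.inv_eq_zero]
    exact (tsub_le_self.trans_lt (by simp : (2⁻¹ : ℝ≥0∞) < ∞)).ne
  obtain ⟨κ, hκ, hW⟩ := exists_eLpNorm_indicator_norm_rpow_le (V := V) hα
    (by rw [hqr]; exact hlt) hq0
  rw [hqr] at hW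
  set v := (volume (Metric.ball (0 : V) 1)).toReal with hv
  have hvball : ∀ {r : ℝ}, 0 < r →
      volume (Metric.closedBall (0 : V) r) = ENNReal.ofReal (r ^ (n : ℝ) * v) := fun {r} hr => by
    rw [Measure.addHaar_closedBall _ _ hr.le, hv, ENNReal.ofReal_mul (by positivity),
      ENNReal.ofReal_toReal measure_ball_lt_top.ne, Real.rpow_natCast]
  have hv0 : 0 ≤ v := ENNReal.toReal_nonneg
  obtain ⟨C, hC, hfinal⟩ := exists_mul_le_of_forall_scale (α := α) (γ := n * (1 / 2 - a))
    (s := n * (1 - a)) (H := H) (c₁ := v ^ (1 / 2 - a) * v ^ (1 / 2 : ℝ) * v ^ (1 - a))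
    (c₂ := v ^ (1 / 2 - a) * κ) hα
    (mul_nonneg hnpos.le (by linarith)) (mul_pos hnpos (by linarith)) hH (by positivity)
    (by positivity)
  refine ⟨C, hC, fun f => ?_⟩
  set N := eLpNorm f p volume with hN
  set M := eLpNorm (𝓕 (f : V → ℂ)) p' volume with hM
  set A := eLpNorm (fun x => ‖x‖ ^ α * ‖f x‖) p volume with hA
  set B := eLpNorm (fun ξ => ‖ξ‖ ^ α * ‖𝓕 (f : V → ℂ) ξ‖) p' volume with hB
  by_cases hf0 : ∀ x, f x = 0
  · have : N = 0 := by
      rw [hN, eLpNorm_congr_ae (g := fun _ => 0) (ae_of_all _ hf0)]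
      simp
    rw [this, zero_mul]
    exact zero_le
  push Not at hf0
  obtain ⟨x, hx⟩ := hf0
  have hFcont : Continuous (𝓕 (f : V → ℂ)) := continuous_fourier_of_integrable f.integrable
  have hN0 : 0 < N := eLpNorm_pos_of_continuous f.continuous hp0 hx
  have hNt : N < ∞ := (f.memLp p volume).2
  have hMt : M < ∞ := by
    rw [hM, ← SchwartzMap.fourier_coe]
    exact ((𝓕 f : SchwartzMap V ℂ).memLp p' volume).2
  have hM0 : 0 < M := by
    rw [pos_iff_ne_zero]
    intro h
    have := hHY f
    rw [← hM, h, mul_zero] at this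
    exact hN0.not_ge this
  obtain ⟨y, hy⟩ : ∃ y, 𝓕 (f : V → ℂ) y ≠ 0 := by
    by_contra! h
    rw [hM, eLpNorm_congr_ae (g := fun _ => 0) (ae_of_all _ h)] at hM0
    simp at hM0
  have hA0 : 0 < A := eLpNorm_weight_pos f.continuous hp0 hα hn hx
  have hB0 : 0 < B := eLpNorm_weight_pos hFcont hp'0 hα hn hy
  by_cases hAt : A = ∞
  · rw [hAt, ENNReal.top_mul hB0.ne', ENNReal.mul_top (by simpa using hC)]
    exact le_top
  by_cases hBt : B = ∞
  · rw [hBt, ENNReal.mul_top hA0.ne', ENNReal.mul_top (by simpa using hC)]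
    exact le_top
  have hNr := ENNReal.ofReal_toReal hNt.ne
  have hMr := ENNReal.ofReal_toReal hMt.ne
  have hAr := ENNReal.ofReal_toReal hAt
  have hBr := ENNReal.ofReal_toReal hBt
  have hNp := ENNReal.toReal_pos hN0.ne' hNt.ne
  have hMp := ENNReal.toReal_pos hM0.ne' hMt.ne
  have hAp := ENNReal.toReal_pos hA0.ne' hAt
  have hBp := ENNReal.toReal_pos hB0.ne' hBt
  rw [← hNr, ← hMr, ← hAr, ← hBr, ← ENNReal.ofReal_mul hNp.le, ← ENNReal.ofReal_mul hAp.le,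
    ← ENNReal.ofReal_mul hC.le]
  refine ENNReal.ofReal_le_ofReal (hfinal _ _ _ _ hMp hNp hAp hBp ?_ fun r R hr hR => ?_)
  · have := hHY f
    rw [← hM, ← hN, ← hNr, ← hMr, ← ENNReal.ofReal_mul hH.le] at this
    exact (ENNReal.ofReal_le_ofReal_iff (by positivity)).1 this
  · have h1 := eLpNorm_fourier_le_of_split hp hconj hq hα f hr hR
    have h2 := h1.trans (add_le_add_right (mul_le_mul_right (add_le_add_right
      (mul_le_mul_left (hW r hr) _) _) _) _)
    rw [← hN, ← hM, ← hA, ← hB, ← ha, hvball hr, hvball hR, ← hNr, ← hMr, ← hAr, ← hBr,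
      ENNReal.ofReal_rpow_of_nonneg (by positivity) (by linarith),
      ENNReal.ofReal_rpow_of_nonneg (by positivity) (by linarith),
      ENNReal.ofReal_rpow_of_nonneg (by positivity) (by linarith),
      ← ENNReal.ofReal_mul (by positivity), ← ENNReal.ofReal_mul (by positivity),
      ← ENNReal.ofReal_mul (by positivity), ← ENNReal.ofReal_mul (by positivity),
      ← ENNReal.ofReal_add (by positivity) (by positivity), ← ENNReal.ofReal_mul (by positivity),
      ← ENNReal.ofReal_add (by positivity) (by positivity),
      ENNReal.ofReal_le_ofReal_iff (by positivity)] at h2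
    refine h2.trans_eq ?_
    congr 1
    rw [Real.mul_rpow (by positivity) hv0, Real.mul_rpow (by positivity) hv0,
      Real.mul_rpow (by positivity) hv0, Real.mul_rpow hR.le hr.le, Real.mul_rpow hR.le hr.le,
      ← Real.rpow_mul hR.le, ← Real.rpow_mul hR.le, ← Real.rpow_mul hr.le, Real.rpow_sub hr,
      Real.rpow_neg hr.le α, show (n:ℝ) * (1 - a) = n * (1 / 2 - a) + n * (1 / 2) by ring,
      Real.rpow_add hR]
    ring

end Sufficiency

theorem Function.HasTemperateGrowth.fderiv_real {E F : Type*} [NormedAddCommGroup E] [NormedSpace ℝ E]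
    [NormedAddCommGroup F] [NormedSpace ℝ F] {P : E → F} (hP : P.HasTemperateGrowth) :
    (fderiv ℝ P).HasTemperateGrowth := by
  refine ⟨hP.1.fderiv_right (m := (⊤ : ℕ∞)) (by simp), fun n => ?_⟩
  obtain ⟨k, C, h⟩ := hP.2 (n + 1)
  exact ⟨k, C, fun x => by rw [norm_iteratedFDeriv_fderiv]; exact h x⟩

theorem exists_one_add_pow_mul_exp_neg_le {c : ℝ} (hc : 0 < c) (N : ℕ) :
    ∃ D : ℝ, ∀ t : ℝ, 0 ≤ t → (1 + t) ^ N * Real.exp (-c * t ^ 2) ≤ D := by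
  refine ⟨N.factorial * Real.exp (1 + 1 / (4 * c)), fun t ht => ?_⟩
  have h1 := Real.pow_div_factorial_le_exp (1 + t) (by positivity) N
  rw [div_le_iff₀ (by positivity)] at h1
  have h2 : 1 + t + -c * t ^ 2 ≤ 1 + 1 / (4 * c) := by
    have h3 : 1 / (4 * c) - t + c * t ^ 2 = (2 * c * t - 1) ^ 2 / (4 * c) := by
      field_simp
      ring
    have h4 : 0 ≤ (2 * c * t - 1) ^ 2 / (4 * c) := by positivity
    linarith
  calc (1 + t) ^ N * Real.exp (-c * t ^ 2) ≤
        (Real.exp (1 + t) * N.factorial) * Real.exp (-c * t ^ 2) := by gcongr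
    _ = N.factorial * Real.exp (1 + t + -c * t ^ 2) := by rw [Real.exp_add (1 + t)]; ring
    _ ≤ _ := by gcongr

theorem norm_cexp_neg_mul_norm_sq {W : Type*} [NormedAddCommGroup W] (b : ℂ) (x : W) :
    ‖Complex.exp (-b * (‖x‖ : ℂ) ^ 2)‖ = Real.exp (-b.re * ‖x‖ ^ 2) := by
  rw [Complex.norm_exp, ← Complex.ofReal_pow, Complex.re_mul_ofReal, Complex.neg_re]

section Gaussian

variable {W : Type*} [NormedAddCommGroup W] [InnerProductSpace ℝ W]

theorem hasFDerivAt_cexp_neg_mul_sq (b : ℂ) (x : W) :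
    HasFDerivAt (fun x : W => Complex.exp (-b * (‖x‖ : ℂ) ^ 2))
      ((innerSL ℝ x).smulRight (Complex.exp (-b * (‖x‖ : ℂ) ^ 2) * (-2 * b))) x := by
  have h1 : HasFDerivAt (fun x : W => ‖x‖ ^ 2) (2 • innerSL ℝ x) x :=
    (hasStrictFDerivAt_norm_sq x).hasFDerivAt
  have h2 := ((Complex.ofRealCLM.hasFDerivAt.comp x h1).const_mul (-b)).cexp
  refine (h2.congr_fderiv ?_).congr_of_eventuallyEq ?_
  · ext v
    simp
    ring
  · exact Filter.Eventually.of_forall fun y => by simp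

theorem contDiff_cexp_neg_mul_sq (b : ℂ) :
    ContDiff ℝ (⊤ : ℕ∞) (fun x : W => Complex.exp (-b * (‖x‖ : ℂ) ^ 2)) := by
  have h : ContDiff ℝ (⊤ : ℕ∞) (fun x : W => Complex.exp (-b * Complex.ofRealCLM (‖x‖ ^ 2))) :=
    (contDiff_const.mul (Complex.ofRealCLM.contDiff.comp (contDiff_norm_sq ℝ))).cexp
  simpa using h

end Gaussian

theorem exists_pow_mul_iteratedFDeriv_gaussian_smul_le {V : Type} [NormedAddCommGroup V]
    [InnerProductSpace ℝ V] {b : ℂ} (hb : 0 < b.re) (n k : ℕ) :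
    ∀ (F : Type) [NormedAddCommGroup F] [NormedSpace ℝ F] [NormedSpace ℂ F] [IsScalarTower ℝ ℂ F]
      (P : V → F), P.HasTemperateGrowth → ∃ C : ℝ, ∀ x : V, ‖x‖ ^ k *
        ‖iteratedFDeriv ℝ n (fun x : V => Complex.exp (-b * (‖x‖ : ℂ) ^ 2) • P x) x‖ ≤ C := by
  induction n with
  | zero =>
    intro F _ _ _ _ P hP
    obtain ⟨m, C, hC⟩ := hP.2 0
    obtain ⟨D, hD⟩ := exists_one_add_pow_mul_exp_neg_le hb (k + m)
    refine ⟨C * D, fun x => ?_⟩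
    have hC0 := hC x
    rw [norm_iteratedFDeriv_zero] at hC0
    have hCnn : 0 ≤ C := nonneg_of_mul_nonneg_left ((norm_nonneg _).trans hC0) (by positivity)
    rw [norm_iteratedFDeriv_zero, norm_smul, norm_cexp_neg_mul_norm_sq]
    calc ‖x‖ ^ k * (Real.exp (-b.re * ‖x‖ ^ 2) * ‖P x‖) ≤
          (1 + ‖x‖) ^ k * (Real.exp (-b.re * ‖x‖ ^ 2) * (C * (1 + ‖x‖) ^ m)) := by
            gcongr
            linarith
      _ = C * ((1 + ‖x‖) ^ (k + m) * Real.exp (-b.re * ‖x‖ ^ 2)) := by ring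
      _ ≤ C * D := by gcongr; exact hD _ (norm_nonneg _)
  | succ n ih =>
    intro F _ _ _ _ P hP
    have hQ : (fun x : V => fderiv ℝ P x +
        ContinuousLinearMap.smulRightL ℝ V F (innerSL ℝ x) ((-2 * b) • P x)).HasTemperateGrowth := by
      refine hP.fderiv_real.add ?_
      refine (ContinuousLinearMap.smulRightL ℝ V F).bilinear_hasTemperateGrowth
        (innerSL ℝ).hasTemperateGrowth ?_
      exact (Function.HasTemperateGrowth.const (-2 * b)).smul hP
    obtain ⟨C, hC⟩ := ih (V →L[ℝ] F) _ hQ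
    refine ⟨C, fun x => ?_⟩
    rw [← norm_iteratedFDeriv_fderiv]
    have hfd : fderiv ℝ (fun x : V => Complex.exp (-b * (‖x‖ : ℂ) ^ 2) • P x) =
        fun x => Complex.exp (-b * (‖x‖ : ℂ) ^ 2) • (fderiv ℝ P x +
          ContinuousLinearMap.smulRightL ℝ V F (innerSL ℝ x) ((-2 * b) • P x)) := by
      ext1 y
      have hd : DifferentiableAt ℝ P y := (hP.1.differentiable (by simp)).differentiableAt
      refine ((hasFDerivAt_cexp_neg_mul_sq b y).smul hd.hasFDerivAt).fderiv.trans ?_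
      ext v
      change Complex.exp (-b * (‖y‖ : ℂ) ^ 2) • fderiv ℝ P y v +
        ((innerSL ℝ) y v • (Complex.exp (-b * (‖y‖ : ℂ) ^ 2) * (-2 * b))) • P y =
        Complex.exp (-b * (‖y‖ : ℂ) ^ 2) • (fderiv ℝ P y v + (innerSL ℝ) y v • (-2 * b) • P y)
      rw [smul_add, smul_assoc, smul_comm _ ((innerSL ℝ) y v), smul_smul]
    rw [hfd]
    exact hC x

/-- The Gaussian `x ↦ exp (-b ‖x‖²)`, `Re b > 0`, as a Schwartz function. -/
noncomputable def gaussianSchwartz (V : Type) [NormedAddCommGroup V] [InnerProductSpace ℝ V]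
    (b : ℂ) (hb : 0 < b.re) : SchwartzMap V ℂ where
  toFun x := Complex.exp (-b * (‖x‖ : ℂ) ^ 2)
  smooth' := contDiff_cexp_neg_mul_sq b
  decay' k n := by
    simpa using exists_pow_mul_iteratedFDeriv_gaussian_smul_le hb n k ℂ (fun _ : V => 1)
      (Function.HasTemperateGrowth.const 1)

theorem norm_gaussianSchwartz {V : Type} [NormedAddCommGroup V] [InnerProductSpace ℝ V]
    {b : ℂ} (hb : 0 < b.re) (x : V) :
    ‖gaussianSchwartz V b hb x‖ = Real.exp (-b.re * ‖x‖ ^ 2) :=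
  norm_cexp_neg_mul_norm_sq b x

section ConcentratedGaussian

variable {V : Type} [NormedAddCommGroup V] [InnerProductSpace ℝ V] [FiniteDimensional ℝ V]
  [MeasurableSpace V] [BorelSpace V]

theorem fourier_gaussianSchwartz {b : ℂ} (hb : 0 < b.re) (w : V) :
    𝓕 (gaussianSchwartz V b hb : V → ℂ) w =
      (Real.pi / b) ^ (Module.finrank ℝ V / 2 : ℂ) *
        Complex.exp (-Real.pi ^ 2 * ‖w‖ ^ 2 / b) :=
  fourier_gaussian_innerProductSpace hb w

theorem memLp_exp_neg_mul_sq {c : ℝ} (hc : 0 < c) (p : ℝ≥0∞) :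
    MemLp (fun x : V => Real.exp (-c * ‖x‖ ^ 2)) p volume := by
  have hc' : 0 < (c : ℂ).re := by simpa using hc
  refine ((gaussianSchwartz V (c : ℂ) hc').memLp p volume).of_le
    (Continuous.aestronglyMeasurable (by fun_prop)) (ae_of_all _ fun x => ?_)
  rw [norm_gaussianSchwartz, Complex.ofReal_re, Real.norm_of_nonneg (by positivity)]

theorem memLp_rpow_mul_exp_neg_mul_sq {c α : ℝ} (hc : 0 < c) (hα : 0 ≤ α) (p : ℝ≥0∞) :
    MemLp (fun x : V => ‖x‖ ^ α * Real.exp (-c * ‖x‖ ^ 2)) p volume := by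
  obtain ⟨D, hD⟩ := exists_one_add_pow_mul_exp_neg_le (half_pos hc) ⌈α⌉₊
  refine ((memLp_exp_neg_mul_sq (V := V) (half_pos hc) p).const_mul D).of_le
    (Measurable.aestronglyMeasurable (by fun_prop)) (ae_of_all _ fun x => ?_)
  have h0 := hD ‖x‖ (norm_nonneg x)
  have hD0 : 0 ≤ D := le_trans (by positivity) h0
  rw [Real.norm_of_nonneg (by positivity), Real.norm_of_nonneg (by positivity)]
  have h1 : ‖x‖ ^ α ≤ (1 + ‖x‖) ^ ⌈α⌉₊ := by
    rw [← Real.rpow_natCast]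
    calc ‖x‖ ^ α ≤ (1 + ‖x‖) ^ α := by gcongr; linarith
      _ ≤ _ := Real.rpow_le_rpow_of_exponent_le (by linarith [norm_nonneg x]) (Nat.le_ceil α)
  have h2 : Real.exp (-c * ‖x‖ ^ 2) =
      Real.exp (-(c / 2) * ‖x‖ ^ 2) * Real.exp (-(c / 2) * ‖x‖ ^ 2) := by
    rw [← Real.exp_add]
    ring_nf
  rw [h2, ← mul_assoc]
  gcongr
  exact (mul_le_mul_of_nonneg_right h1 (by positivity)).trans h0

theorem exists_concentrated_gaussian {p p' : ℝ≥0∞} (hp : 2 ≤ p) (hconj : 1 / p + 1 / p' = 1)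
    (hn : 0 < Module.finrank ℝ V) {α β : ℝ} (hα : 0 < α) (hβ : 0 < β) :
    ∃ N₀ M₀ A₀ B₀ : ℝ, 0 < N₀ ∧ 0 < M₀ ∧ 0 < A₀ ∧ 0 < B₀ ∧ ∀ δ τ : ℝ, 0 < δ → 0 < τ →
      ∃ h : SchwartzMap V ℂ, eLpNorm h p volume = ENNReal.ofReal (τ * N₀) ∧
        eLpNorm (𝓕 (h : V → ℂ)) p' volume = ENNReal.ofReal (τ * M₀) ∧
        eLpNorm (fun x => ‖x‖ ^ α * ‖h x‖) p volume = ENNReal.ofReal (τ * δ ^ α * A₀) ∧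
        eLpNorm (fun ξ => ‖ξ‖ ^ β * ‖𝓕 (h : V → ℂ) ξ‖) p' volume =
          ENNReal.ofReal (τ * δ ^ (-β) * B₀) := by
  have hp0 : p ≠ 0 := (zero_lt_two.trans_le hp).ne'
  have hp'0 : p' ≠ 0 := (zero_lt_one.trans_le (one_le_conj_le_two hp hconj).1).ne'
  have hpp := toReal_one_div_conj hp hconj
  set n := Module.finrank ℝ V with hndef
  set a := (1 / p).toReal with ha
  set G : V → ℝ := fun x => Real.exp (-Real.pi * ‖x‖ ^ 2) with hG
  have hGc : Continuous G := by fun_prop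
  have hG0 : ∀ x, 0 < G x := fun x => Real.exp_pos _
  have hGw : ∀ s : ℝ, (fun x => ‖x‖ ^ s * ‖G x‖) = fun x => ‖x‖ ^ s * G x := fun s => by
    ext x
    rw [Real.norm_of_nonneg (hG0 x).le]
  have hN := eLpNorm_pos_of_continuous hGc hp0 (x := 0) (hG0 0).ne'
  have hM := eLpNorm_pos_of_continuous hGc hp'0 (x := 0) (hG0 0).ne'
  have hA := eLpNorm_weight_pos hGc hp0 hα hn (x := 0) (hG0 0).ne'
  have hB := eLpNorm_weight_pos hGc hp'0 hβ hn (x := 0) (hG0 0).ne'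
  rw [hGw] at hA hB
  have hNt := (memLp_exp_neg_mul_sq (V := V) Real.pi_pos p).2.ne
  have hMt := (memLp_exp_neg_mul_sq (V := V) Real.pi_pos p').2.ne
  have hAt := (memLp_rpow_mul_exp_neg_mul_sq (V := V) Real.pi_pos hα.le p).2.ne
  have hBt := (memLp_rpow_mul_exp_neg_mul_sq (V := V) Real.pi_pos hβ.le p').2.ne
  refine ⟨_, _, _, _, ENNReal.toReal_pos hN.ne' hNt, ENNReal.toReal_pos hM.ne' hMt,
    ENNReal.toReal_pos hA.ne' hAt, ENNReal.toReal_pos hB.ne' hBt, fun δ τ hδ hτ => ?_⟩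
  set b : ℂ := ((Real.pi / δ ^ 2 : ℝ) : ℂ) with hb
  have hbre : 0 < b.re := by
    rw [hb, Complex.ofReal_re]
    positivity
  set s : ℝ := τ * δ ^ (-(n * a)) with hs
  have hs0 : 0 < s := by positivity
  have hdil : ∀ {c : ℝ}, 0 < c → ∀ x : V, ‖c • x‖ = c * ‖x‖ := fun {c} hc x => by
    rw [norm_smul, Real.norm_of_nonneg hc.le]
  have hδi : 0 < δ⁻¹ := by positivity
  have hhx : ∀ x, ‖((s : ℂ) • gaussianSchwartz V b hbre) x‖ = s * G (δ⁻¹ • x) := fun x => by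
    rw [smul_apply, norm_smul, norm_gaussianSchwartz, Complex.norm_real,
      Real.norm_of_nonneg hs0.le, hG]
    beta_reduce
    rw [hdil hδi, hb, Complex.ofReal_re]
    congr 2
    field_simp
  have hhξ : ∀ ξ, ‖𝓕 (((s : ℂ) • gaussianSchwartz V b hbre : SchwartzMap V ℂ) : V → ℂ) ξ‖ =
      (s * δ ^ (n : ℝ)) * G (δ • ξ) := fun ξ => by
    have h1 : 𝓕 (((s : ℂ) • gaussianSchwartz V b hbre : SchwartzMap V ℂ) : V → ℂ) ξ =
        (s : ℂ) * 𝓕 (gaussianSchwartz V b hbre : V → ℂ) ξ := by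
      rw [← SchwartzMap.fourier_coe, FourierTransform.fourier_smul, smul_apply,
        SchwartzMap.fourier_coe, smul_eq_mul]
    have h2 : (Real.pi / b : ℂ) = ((δ ^ 2 : ℝ) : ℂ) := by
      rw [hb, ← Complex.ofReal_div]
      congr 1
      field_simp
    have h3 : (-Real.pi ^ 2 * ‖ξ‖ ^ 2 / b : ℂ) = ((-Real.pi * ‖δ • ξ‖ ^ 2 : ℝ) : ℂ) := by
      have h4 : (-Real.pi ^ 2 * ‖ξ‖ ^ 2 / b : ℂ) = -Real.pi * ‖ξ‖ ^ 2 * (Real.pi / b) := by ring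
      rw [h4, h2, hdil hδ]
      push_cast
      ring
    have h5 : (Module.finrank ℝ V / 2 : ℂ).re = (n : ℝ) / 2 := by
      simp [hndef]
    rw [h1, fourier_gaussianSchwartz, h2, h3, norm_mul, norm_mul, Complex.norm_real,
      Real.norm_of_nonneg hs0.le, ← Complex.ofReal_exp, Complex.norm_real,
      Real.norm_of_nonneg (by positivity), Complex.norm_cpow_eq_rpow_re_of_pos (by positivity),
      h5, ← Real.rpow_natCast δ 2, ← Real.rpow_mul hδ.le,
      show ((2 : ℕ) : ℝ) * ((n : ℝ) / 2) = n by push_cast; ring, mul_assoc s]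
  have hcalc : ∀ (F : V → ℝ) (r : ℝ≥0∞) (k c : ℝ), 0 < k → 0 < c → eLpNorm F r volume ≠ ∞ →
      eLpNorm (fun x => k * F (c • x)) r volume =
        ENNReal.ofReal (k * c ^ (-(n * (1 / r).toReal)) * (eLpNorm F r volume).toReal) := by
    intro F r k c hk hc hF
    have : (fun x => k * F (c • x)) = k • fun x => F (c • x) := rfl
    rw [this, eLpNorm_const_smul, eLpNorm_comp_smul F r hc, Real.enorm_of_nonneg hk.le,
      ENNReal.ofReal_mul (by positivity), ENNReal.ofReal_mul hk.le, ENNReal.ofReal_toReal hF,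
      mul_assoc]
  refine ⟨(s : ℂ) • gaussianSchwartz V b hbre, ?_, ?_, ?_, ?_⟩
  · rw [eLpNorm_congr_norm_ae (g := fun x => s * G (δ⁻¹ • x)), hcalc G p s _ hs0 hδi hNt]
    · congr 2
      rw [← ha, Real.inv_rpow hδ.le, ← Real.rpow_neg hδ.le, hs, mul_assoc, ← Real.rpow_add hδ]
      simp
    · refine ae_of_all _ fun x => ?_
      rw [hhx, Real.norm_of_nonneg (mul_nonneg hs0.le (hG0 _).le)]
  · rw [eLpNorm_congr_norm_ae (g := fun x => (s * δ ^ (n : ℝ)) * G (δ • x)),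
      hcalc G p' _ _ (by positivity) hδ hMt]
    · congr 2
      rw [hpp, hs, mul_assoc, mul_assoc, ← Real.rpow_add hδ, ← Real.rpow_add hδ]
      ring_nf
      simp
    · refine ae_of_all _ fun x => ?_
      rw [hhξ, Real.norm_of_nonneg (mul_nonneg (by positivity) (hG0 _).le)]
  · have : (fun x => ‖x‖ ^ α * ‖((s : ℂ) • gaussianSchwartz V b hbre) x‖) =
        fun x => (s * δ ^ α) * (fun x => ‖x‖ ^ α * G x) (δ⁻¹ • x) := by
      ext x
      rw [hhx]
      beta_reduce
      rw [hdil hδi, Real.mul_rpow hδi.le (norm_nonneg _), Real.inv_rpow hδ.le]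
      field_simp
    rw [this, hcalc _ p _ _ (by positivity) hδi hAt]
    congr 2
    rw [← ha, Real.inv_rpow hδ.le, ← Real.rpow_neg hδ.le, hs, mul_assoc, mul_assoc,
      ← Real.rpow_add hδ, ← Real.rpow_add hδ]
    ring_nf
  · have : (fun x => ‖x‖ ^ β *
        ‖𝓕 (((s : ℂ) • gaussianSchwartz V b hbre : SchwartzMap V ℂ) : V → ℂ) x‖) =
        fun x => (s * δ ^ (n : ℝ) * δ ^ (-β)) * (fun x => ‖x‖ ^ β * G x) (δ • x) := by
      ext x
      rw [hhξ]
      beta_reduce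
      rw [hdil hδ, Real.mul_rpow hδ.le (norm_nonneg _), Real.rpow_neg hδ.le]
      field_simp
    rw [this, hcalc _ p' _ _ (by positivity) hδ hBt]
    congr 2
    rw [hpp, hs, mul_assoc, mul_assoc, mul_assoc, ← Real.rpow_add hδ, ← Real.rpow_add hδ,
      ← Real.rpow_add hδ]
    ring_nf

end ConcentratedGaussian

section RandomSigns

/-- The sign `±1` attached to a boolean. -/
def boolSign (b : Bool) : ℂ := cond b 1 (-1)

theorem sum_boolSign_succ {n : ℕ} (z : Fin (n + 1) → ℂ) (Φ : ℂ → ℝ) :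
    ∑ ε : Fin (n + 1) → Bool, Φ (∑ k, boolSign (ε k) * z k) =
      ∑ ε : Fin n → Bool, (Φ ((∑ k, boolSign (ε k) * z k.succ) + z 0) +
        Φ ((∑ k, boolSign (ε k) * z k.succ) - z 0)) := by
  rw [← (Fin.consEquiv fun _ => Bool).sum_comp, Fintype.sum_prod_type_right]
  refine Finset.sum_congr rfl fun ε _ => ?_
  rw [Fintype.sum_bool]
  simp only [Fin.consEquiv_apply, Fin.sum_univ_succ, Fin.cons_zero, Fin.cons_succ]
  simp only [boolSign, cond_true, cond_false]
  congr 2 <;> ring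

theorem sum_norm_sum_boolSign_sq {n : ℕ} (z : Fin n → ℂ) :
    ∑ ε : Fin n → Bool, ‖∑ k, boolSign (ε k) * z k‖ ^ 2 = 2 ^ n * ∑ k, ‖z k‖ ^ 2 := by
  induction n with
  | zero => simp
  | succ n ih =>
    rw [sum_boolSign_succ z fun w => ‖w‖ ^ 2]
    have h : ∀ u v : ℂ, ‖u + v‖ ^ 2 + ‖u - v‖ ^ 2 = 2 * ‖u‖ ^ 2 + 2 * ‖v‖ ^ 2 := fun u v => by
      simp only [Complex.sq_norm, Complex.normSq_apply, Complex.add_re, Complex.add_im,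
        Complex.sub_re, Complex.sub_im]
      ring
    simp only [h]
    rw [Finset.sum_add_distrib, ← Finset.mul_sum, ih, Fin.sum_univ_succ]
    simp only [Finset.sum_const, Finset.card_univ, Fintype.card_fun, Fintype.card_bool,
      Fintype.card_fin, nsmul_eq_mul]
    push_cast
    ring

theorem sum_norm_sum_boolSign_pow_four_le {n : ℕ} (z : Fin n → ℂ) :
    ∑ ε : Fin n → Bool, ‖∑ k, boolSign (ε k) * z k‖ ^ 4 ≤ 2 ^ n * (3 * (∑ k, ‖z k‖ ^ 2) ^ 2) := by
  induction n with
  | zero => simp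
  | succ n ih =>
    rw [sum_boolSign_succ z fun w => ‖w‖ ^ 4]
    have h : ∀ u v : ℂ, ‖u + v‖ ^ 4 + ‖u - v‖ ^ 4 ≤
        2 * ‖u‖ ^ 4 + 12 * ‖v‖ ^ 2 * ‖u‖ ^ 2 + 2 * ‖v‖ ^ 4 := fun u v => by
      have h4 : ∀ w : ℂ, ‖w‖ ^ 4 = (‖w‖ ^ 2) ^ 2 := fun w => by ring
      simp only [h4, Complex.sq_norm, Complex.normSq_apply, Complex.add_re, Complex.add_im,
        Complex.sub_re, Complex.sub_im]
      nlinarith [sq_nonneg (u.re * v.im - u.im * v.re)]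
    calc _ ≤ ∑ ε : Fin n → Bool, (2 * ‖∑ k, boolSign (ε k) * z k.succ‖ ^ 4 +
          12 * ‖z 0‖ ^ 2 * ‖∑ k, boolSign (ε k) * z k.succ‖ ^ 2 + 2 * ‖z 0‖ ^ 4) :=
          Finset.sum_le_sum fun ε _ => h _ _
      _ = 2 * ∑ ε : Fin n → Bool, ‖∑ k, boolSign (ε k) * z k.succ‖ ^ 4 +
          12 * ‖z 0‖ ^ 2 * (2 ^ n * ∑ k : Fin n, ‖z k.succ‖ ^ 2) + 2 ^ n * (2 * ‖z 0‖ ^ 4) := by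
        rw [Finset.sum_add_distrib, Finset.sum_add_distrib, ← Finset.mul_sum, ← Finset.mul_sum,
          sum_norm_sum_boolSign_sq]
        simp
      _ ≤ 2 * (2 ^ n * (3 * (∑ k : Fin n, ‖z k.succ‖ ^ 2) ^ 2)) +
          12 * ‖z 0‖ ^ 2 * (2 ^ n * ∑ k : Fin n, ‖z k.succ‖ ^ 2) + 2 ^ n * (2 * ‖z 0‖ ^ 4) := by
        gcongr
        exact ih _
      _ ≤ _ := by
        rw [Fin.sum_univ_succ]
        have : (0 : ℝ) ≤ 2 ^ n * ‖z 0‖ ^ 4 := by positivity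
        rw [pow_succ (2 : ℝ) n]
        nlinarith

theorem exists_sign_choice {X : Type*} [MeasurableSpace X] {μ : Measure X} {n : ℕ} (hn : 0 < n)
    {z : Fin n → X → ℂ} (hz : ∀ k, Measurable (z k)) (hz1 : ∀ k x, ‖z k x‖ = 1) {u U : X → ℝ}
    (hu : Integrable u μ) (hU : Integrable U μ) (hu0 : ∀ x, 0 ≤ u x)
    (hU0 : ∀ x, 0 ≤ U x) (huI : 0 < ∫ x, u x ∂μ) (hUJ : 0 < ∫ x, U x ∂μ) :
    ∃ ε : Fin n → Bool, ∀ Q : X → ℝ,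
      (∀ x, Q x = ‖((√n)⁻¹ : ℂ) * ∑ k, boolSign (ε k) * z k x‖) →
      Integrable (fun x => u x * (Q x ^ 2 - Q x ^ 4 / 6)) μ ∧
      Integrable (fun x => U x * (1 + Q x ^ 2)) μ ∧
      (∫ x, u x ∂μ) / 4 ≤ ∫ x, u x * (Q x ^ 2 - Q x ^ 4 / 6) ∂μ ∧
      ∫ x, U x * (1 + Q x ^ 2) ∂μ ≤ 12 * ∫ x, U x ∂μ := by
  set I := ∫ x, u x ∂μ with hI
  set J := ∫ x, U x ∂μ with hJ
  set Q : (Fin n → Bool) → X → ℝ :=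
    fun ε x => ‖((√n)⁻¹ : ℂ) * ∑ k, boolSign (ε k) * z k x‖ with hQ
  have hnR : (0 : ℝ) < n := by exact_mod_cast hn
  have hQm : ∀ ε, Measurable (Q ε) := fun ε => by
    refine (Measurable.const_mul (Finset.measurable_sum _ fun k _ => ?_) _).norm
    exact (hz k).const_mul _
  have hnorm : ∀ ε x, Q ε x = (√n)⁻¹ * ‖∑ k, boolSign (ε k) * z k x‖ := fun ε x => by
    rw [hQ]
    simp
  have hQb : ∀ ε x, Q ε x ≤ (√n)⁻¹ * n := fun ε x => by
    rw [hnorm]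
    gcongr
    refine (norm_sum_le _ _).trans ?_
    have : ∀ k, ‖boolSign (ε k) * z k x‖ = 1 := fun k => by
      rw [norm_mul, hz1, mul_one]
      cases ε k <;> simp [boolSign]
    rw [Finset.sum_congr rfl fun k _ => this k]
    simp
  have hQ0 : ∀ ε x, 0 ≤ Q ε x := fun ε x => norm_nonneg _
  have hsq : ∀ x, ∑ ε, Q ε x ^ 2 = 2 ^ n := fun x => by
    simp only [hnorm, mul_pow]
    rw [← Finset.mul_sum, sum_norm_sum_boolSign_sq]
    simp only [hz1, inv_pow, Real.sq_sqrt hnR.le]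
    simp
    field_simp
  have hfour : ∀ x, ∑ ε, Q ε x ^ 4 ≤ 2 ^ n * 3 := fun x => by
    simp only [hnorm, mul_pow]
    rw [← Finset.mul_sum]
    refine (mul_le_mul_of_nonneg_left (sum_norm_sum_boolSign_pow_four_le _)
      (by positivity)).trans_eq ?_
    have : (√(n : ℝ))⁻¹ ^ 4 = ((n : ℝ) ^ 2)⁻¹ := by
      rw [inv_pow, show (√(n : ℝ)) ^ 4 = (√(n : ℝ) ^ 2) ^ 2 by ring, Real.sq_sqrt hnR.le]
    rw [this]
    simp only [hz1]
    simp
    field_simp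
  have hi1 : ∀ ε, Integrable (fun x => u x * (Q ε x ^ 2 - Q ε x ^ 4 / 6)) μ := fun ε => by
    refine hu.mul_bdd (c := ((√n)⁻¹ * n) ^ 2 + ((√n)⁻¹ * n) ^ 4 / 6)
      (((hQm ε).pow_const 2).sub (((hQm ε).pow_const 4).div_const 6)).aestronglyMeasurable
      (ae_of_all _ fun x => ?_)
    refine (norm_sub_le _ _).trans ?_
    rw [Real.norm_of_nonneg (by positivity), Real.norm_of_nonneg (by positivity)]
    have := hQb ε x
    have := hQ0 ε x
    gcongr
  have hi2 : ∀ ε, Integrable (fun x => U x * (1 + Q ε x ^ 2)) μ := fun ε => by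
    refine hU.mul_bdd (c := 1 + ((√n)⁻¹ * n) ^ 2)
      (((hQm ε).pow_const 2).const_add 1).aestronglyMeasurable (ae_of_all _ fun x => ?_)
    rw [Real.norm_of_nonneg (by positivity)]
    have := hQ0 ε x
    gcongr
    exact hQb ε x
  set δ : ℝ := I / (8 * J) with hδ
  have hδ0 : 0 < δ := by positivity
  set Ψ : (Fin n → Bool) → ℝ := fun ε =>
    ∫ x, u x * (Q ε x ^ 2 - Q ε x ^ 4 / 6) ∂μ - δ * ∫ x, U x * (1 + Q ε x ^ 2) ∂μ with hΨ
  have hsum : ∑ _ε : Fin n → Bool, I / 4 ≤ ∑ ε, Ψ ε := by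
    have e1 : ∑ ε, ∫ x, u x * (Q ε x ^ 2 - Q ε x ^ 4 / 6) ∂μ =
        ∫ x, ∑ ε, u x * (Q ε x ^ 2 - Q ε x ^ 4 / 6) ∂μ :=
      (integral_finsetSum _ fun ε _ => hi1 ε).symm
    have e2 : ∑ ε, ∫ x, U x * (1 + Q ε x ^ 2) ∂μ = ∫ x, ∑ ε, U x * (1 + Q ε x ^ 2) ∂μ :=
      (integral_finsetSum _ fun ε _ => hi2 ε).symm
    have e3 : (2 : ℝ) ^ n * (I / 2) ≤ ∫ x, ∑ ε, u x * (Q ε x ^ 2 - Q ε x ^ 4 / 6) ∂μ := by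
      have : (2 : ℝ) ^ n * (I / 2) = ∫ x, (2 ^ n / 2) * u x ∂μ := by
        rw [integral_const_mul]
        ring
      rw [this]
      refine integral_mono (hu.const_mul _) (integrable_finsetSum _ fun ε _ => hi1 ε) fun x => ?_
      beta_reduce
      rw [← Finset.mul_sum, Finset.sum_sub_distrib, hsq, ← Finset.sum_div, mul_comm]
      have := hfour x
      have := hu0 x
      gcongr
      linarith
    have e4 : ∫ x, ∑ ε, U x * (1 + Q ε x ^ 2) ∂μ = 2 ^ n * 2 * J := by
      rw [hJ, ← integral_const_mul]
      refine integral_congr_ae (ae_of_all _ fun x => ?_)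
      beta_reduce
      rw [← Finset.mul_sum, Finset.sum_add_distrib, hsq]
      simp
      ring
    rw [hΨ, Finset.sum_sub_distrib, ← Finset.mul_sum, e1, e2, e4]
    have e5 : δ * (2 ^ n * 2 * J) = 2 ^ n * (I / 4) := by
      rw [hδ]
      field_simp
      norm_num
    simp only [Finset.sum_const, Finset.card_univ, Fintype.card_fun, Fintype.card_bool,
      Fintype.card_fin, nsmul_eq_mul]
    push_cast
    linarith
  obtain ⟨ε, -, hε⟩ := Finset.exists_le_of_sum_le Finset.univ_nonempty hsum
  have hle : ∫ x, u x * (Q ε x ^ 2 - Q ε x ^ 4 / 6) ∂μ ≤ 3 / 2 * I := by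
    rw [hI, ← integral_const_mul]
    refine integral_mono (hi1 ε) (hu.const_mul _) fun x => ?_
    beta_reduce
    rw [mul_comm (3 / 2)]
    refine mul_le_mul_of_nonneg_left ?_ (hu0 x)
    nlinarith [sq_nonneg (Q ε x ^ 2 - 3)]
  refine ⟨ε, fun Q' hQ' => ?_⟩
  obtain rfl : Q' = Q ε := funext hQ'
  rw [hΨ] at hε
  refine ⟨hi1 ε, hi2 ε, ?_, ?_⟩
  · have : 0 ≤ δ * ∫ x, U x * (1 + Q ε x ^ 2) ∂μ :=
      mul_nonneg hδ0.le (integral_nonneg fun x => mul_nonneg (hU0 x) (by positivity))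
    linarith
  · have h1 : δ * ∫ x, U x * (1 + Q ε x ^ 2) ∂μ ≤ δ * (12 * J) := by
      have : δ * (12 * J) = 3 / 2 * I := by
        rw [hδ]
        field_simp
        norm_num
      linarith
    exact le_of_mul_le_mul_left h1 hδ0

theorem sq_sub_le_rpow {t q : ℝ} (ht : 0 ≤ t) (hq1 : 1 ≤ q) (hq2 : q ≤ 2) :
    t ^ 2 - t ^ 4 / 6 ≤ t ^ q := by
  rcases le_total t 1 with h | h
  · have h1 : t ^ (2 : ℝ) ≤ t ^ q := by
      rcases ht.eq_or_lt with rfl | h0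
      · rw [Real.zero_rpow (by norm_num), Real.zero_rpow (by linarith)]
      · exact Real.rpow_le_rpow_of_exponent_ge h0 h hq2
    rw [Real.rpow_two] at h1
    have : 0 ≤ t ^ 4 := by positivity
    linarith
  · have h1 : t ^ (1 : ℝ) ≤ t ^ q := Real.rpow_le_rpow_of_exponent_le h hq1
    rw [Real.rpow_one] at h1
    refine le_trans ?_ h1
    nlinarith [mul_nonneg ht (sq_nonneg (t - 1)), mul_nonneg ht (mul_nonneg ht (sq_nonneg (t - 1))),
      mul_nonneg ht (mul_nonneg ht (sq_nonneg (t - 3/2))), mul_nonneg ht (sq_nonneg (t - 3 / 2)),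
      mul_nonneg ht (mul_nonneg ht ht)]

theorem rpow_le_one_add_sq {t q : ℝ} (ht : 0 ≤ t) (hq1 : 1 ≤ q) (hq2 : q ≤ 2) :
    t ^ q ≤ 1 + t ^ 2 := by
  rcases le_total t 1 with h | h
  · have := Real.rpow_le_one ht h (by linarith : 0 ≤ q)
    nlinarith [sq_nonneg t]
  · have := Real.rpow_le_rpow_of_exponent_le h hq2
    rw [Real.rpow_two] at this
    linarith

end RandomSigns

section Chirp

variable {V : Type} [NormedAddCommGroup V] [InnerProductSpace ℝ V] [FiniteDimensional ℝ V]
  [MeasurableSpace V] [BorelSpace V]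

theorem eLpNorm_weight_le_of_sup_bound {E : Type*} [NormedAddCommGroup E] {X : Type*}
    [MeasurableSpace X] {μ : Measure X} {p : ℝ≥0∞} (hp : 2 ≤ p) {g : X → E} {W ω : X → ℝ} {D : ℝ}
    (hD : 0 ≤ D) (hW : ∀ x, 0 ≤ W x) (hω : ∀ x, 0 ≤ ω x)
    (hωW : ∀ x, ω x ≤ W x ^ (1 - 2 * (1 / p).toReal)) (hWg : ∀ x, W x * ‖g x‖ ≤ D) :
    eLpNorm (fun x => ω x * ‖g x‖) p μ ≤
      ENNReal.ofReal (D ^ (1 - 2 * (1 / p).toReal)) *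
        eLpNorm g 2 μ ^ (2 * (1 / p).toReal) := by
  by_cases hpt : p = ∞
  · subst hpt
    simp only [one_div, ENNReal.inv_top, ENNReal.toReal_zero, mul_zero, sub_zero, Real.rpow_one,
      ENNReal.rpow_zero, mul_one] at hωW ⊢
    rw [eLpNorm_exponent_top]
    refine eLpNormEssSup_le_of_ae_enorm_bound (ae_of_all _ fun x => ?_)
    rw [Real.enorm_of_nonneg (mul_nonneg (hω x) (norm_nonneg _))]
    exact ENNReal.ofReal_le_ofReal
      ((mul_le_mul_of_nonneg_right (hωW x) (norm_nonneg _)).trans (hWg x))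
  · have hp0 : p ≠ 0 := (zero_lt_two.trans_le hp).ne'
    set P := p.toReal with hP
    have hP2 : 2 ≤ P := by
      have := ENNReal.toReal_mono hpt hp
      simpa using this
    have hP0 : 0 < P := by linarith
    have ha : (1 / p).toReal = 1 / P := by rw [ENNReal.toReal_div, ENNReal.toReal_one]
    rw [ha] at hωW ⊢
    have he : (1 - 2 * (1 / P)) * P = P - 2 := by field_simp
    have hpt' : ∀ x, ‖ω x * ‖g x‖‖ₑ ^ P ≤ ENNReal.ofReal (D ^ (P - 2)) * ‖g x‖ₑ ^ (2 : ℝ) := by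
      intro x
      rw [Real.enorm_of_nonneg (mul_nonneg (hω x) (norm_nonneg _)),
        ENNReal.ofReal_rpow_of_nonneg (mul_nonneg (hω x) (norm_nonneg _)) hP0.le,
        ← ofReal_norm, ENNReal.ofReal_rpow_of_nonneg (norm_nonneg _) zero_le_two,
        ← ENNReal.ofReal_mul (by positivity)]
      refine ENNReal.ofReal_le_ofReal ?_
      have h1 : ω x ^ P ≤ W x ^ (P - 2) := by
        rw [← he, Real.rpow_mul (hW x)]
        exact Real.rpow_le_rpow (hω x) (hωW x) hP0.le
      have h2 : ‖g x‖ ^ P = ‖g x‖ ^ (P - 2) * ‖g x‖ ^ (2 : ℝ) := by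
        rw [← Real.rpow_add_of_nonneg (norm_nonneg _) (by linarith) zero_le_two]
        ring_nf
      rw [Real.mul_rpow (hω x) (norm_nonneg _), h2, ← mul_assoc]
      refine mul_le_mul_of_nonneg_right ?_ (by positivity)
      calc ω x ^ P * ‖g x‖ ^ (P - 2) ≤ W x ^ (P - 2) * ‖g x‖ ^ (P - 2) := by gcongr
        _ = (W x * ‖g x‖) ^ (P - 2) := (Real.mul_rpow (hW x) (norm_nonneg _)).symm
        _ ≤ D ^ (P - 2) := Real.rpow_le_rpow (mul_nonneg (hW x) (norm_nonneg _)) (hWg x)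
          (by linarith)
    rw [eLpNorm_eq_lintegral_rpow_enorm_toReal hp0 hpt,
      eLpNorm_eq_lintegral_rpow_enorm_toReal two_ne_zero ENNReal.ofNat_ne_top, ← hP]
    calc (∫⁻ x, ‖ω x * ‖g x‖‖ₑ ^ P ∂μ) ^ (1 / P)
        ≤ (ENNReal.ofReal (D ^ (P - 2)) * ∫⁻ x, ‖g x‖ₑ ^ (2 : ℝ) ∂μ) ^ (1 / P) := by
          rw [← lintegral_const_mul' _ _ ENNReal.ofReal_ne_top]
          gcongr
          exact hpt' _
      _ = _ := by
        rw [ENNReal.mul_rpow_of_nonneg _ _ (by positivity), ← ENNReal.rpow_mul,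
          ENNReal.ofReal_rpow_of_nonneg (by positivity) (by positivity), ← Real.rpow_mul hD]
        simp only [ENNReal.toReal_ofNat]
        congr 2
        · congr 1
          field_simp
        · field_simp

theorem norm_fourier_chirp {L : ℝ} (hL : 1 ≤ L) {b : ℂ}
    (hb : b = Real.pi * (1 + √(L ^ 2 - 1) * Complex.I)) (hb0 : 0 < b.re) (w : V) :
    ‖𝓕 (gaussianSchwartz V b hb0 : V → ℂ) w‖ =
      L ^ (-(Module.finrank ℝ V / 2 : ℝ)) * Real.exp (-Real.pi * (‖w‖ / L) ^ 2) := by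
  have hL0 : 0 < L := by linarith
  have hL2 : 0 ≤ L ^ 2 - 1 := by nlinarith
  have hs := Real.sq_sqrt hL2
  set T := √(L ^ 2 - 1)
  have hns : Complex.normSq (1 + T * Complex.I) = L ^ 2 := by
    simp [Complex.normSq_apply]
    linarith
  have hnorm : ‖(1 + T * Complex.I : ℂ)‖ = L := by
    rw [Complex.norm_def, hns, Real.sqrt_sq hL0.le]
  have hpi : (Real.pi : ℂ) ≠ 0 := by exact_mod_cast Real.pi_ne_zero
  have hdiv : (Real.pi / b : ℂ) = (1 + T * Complex.I)⁻¹ := by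
    rw [hb, div_mul_eq_div_div, div_self hpi, one_div]
  have hexp : (-Real.pi ^ 2 * ‖w‖ ^ 2 / b : ℂ) =
      ((-Real.pi * ‖w‖ ^ 2 : ℝ) : ℂ) * (1 + T * Complex.I)⁻¹ := by
    rw [← hdiv]
    push_cast
    ring
  have hcast : (Module.finrank ℝ V / 2 : ℂ) = ((Module.finrank ℝ V / 2 : ℝ) : ℂ) := by
    push_cast
    rfl
  rw [fourier_gaussianSchwartz, norm_mul, hcast, Complex.norm_cpow_real, hdiv, norm_inv, hnorm,
    Complex.norm_exp, hexp, Complex.re_ofReal_mul, Complex.inv_re, hns, Real.inv_rpow hL0.le,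
    Real.rpow_neg hL0.le]
  congr 2
  simp
  field_simp

theorem exists_weighted_sum_chirp_le {d : ℕ} (hd : 0 < d) : ∃ K : ℝ, 0 < K ∧ ∀ (n : ℕ) (r : ℝ),
    0 ≤ r → (1 + r ^ (d / 2 : ℝ)) * ∑ k : Fin n, ((4 : ℝ) ^ (k / d : ℝ)) ^ (-(d / 2 : ℝ)) *
      Real.exp (-Real.pi * (r / (4 : ℝ) ^ (k / d : ℝ)) ^ 2) ≤ K := by
  obtain ⟨D, hD⟩ := exists_one_add_pow_mul_exp_neg_le Real.pi_pos (2 * d)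
  have hdR : (0 : ℝ) < d := by exact_mod_cast hd
  have hD0 : 0 ≤ D := le_trans (by positivity) (hD 0 le_rfl)
  refine ⟨2 + 6 * D, by linarith, fun n r hr => ?_⟩
  rw [Fin.sum_univ_eq_sum_range (fun k : ℕ => ((4 : ℝ) ^ (k / d : ℝ)) ^ (-(d / 2 : ℝ)) *
      Real.exp (-Real.pi * (r / (4 : ℝ) ^ (k / d : ℝ)) ^ 2))]
  have hL : ∀ k : ℕ, ((4 : ℝ) ^ (k / d : ℝ)) ^ (-(d / 2 : ℝ)) = (1 / 2) ^ k := fun k => by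
    rw [← Real.rpow_mul (by norm_num), show (k / d * (-(d / 2)) : ℝ) = (1 / 2) * (-(k : ℝ)) by
      field_simp, Real.rpow_mul (by norm_num), ← Real.sqrt_eq_rpow,
      show (4 : ℝ) = 2 ^ 2 by norm_num, Real.sqrt_sq (by norm_num), Real.rpow_neg (by norm_num),
      Real.rpow_natCast, one_div, inv_pow]
  simp only [hL]
  set ρ : ℝ := r ^ (d / 2 : ℝ) with hρ
  have hρ0 : 0 ≤ ρ := by positivity
  set φ : ℕ → ℝ := fun k => ρ * (1 / 2) ^ k / (1 + ρ * (1 / 2) ^ k) with hφ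
  have hterm : ∀ k : ℕ, ρ * ((1 / 2) ^ k * Real.exp (-Real.pi * (r / (4 : ℝ) ^ (k / d : ℝ)) ^ 2)) ≤
      6 * D * (φ k - φ (k + 1)) := fun k => by
    set t := r / (4 : ℝ) ^ (k / d : ℝ) with ht
    have ht0 : 0 ≤ t := by positivity
    set y := ρ * (1 / 2) ^ k with hy
    have hy0 : 0 ≤ y := by positivity
    have hyt : y = t ^ (d / 2 : ℝ) := by
      rw [ht, Real.div_rpow hr (by positivity), hy, ← hL, Real.rpow_neg (by positivity)]
      rfl
    have hy1 : y ≤ (1 + t) ^ d := by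
      rw [hyt, ← Real.rpow_natCast]
      calc t ^ (d / 2 : ℝ) ≤ (1 + t) ^ (d / 2 : ℝ) := by gcongr; linarith
        _ ≤ _ := Real.rpow_le_rpow_of_exponent_le (by linarith) (by linarith)
    have h1 : 1 ≤ (1 + t) ^ d := one_le_pow₀ (by linarith)
    have h2 : (1 + y) * (2 + y) ≤ 6 * (1 + t) ^ (2 * d) := by
      rw [pow_mul', sq]
      nlinarith
    have hφk : φ k - φ (k + 1) = y / ((1 + y) * (2 + y)) := by
      have : φ (k + 1) = (y / 2) / (1 + y / 2) := by
        rw [hφ, hy]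
        beta_reduce
        rw [pow_succ]
        ring_nf
      rw [this, hφ]
      beta_reduce
      rw [← hy]
      field_simp
      ring
    rw [hφk, ← mul_assoc, ← hy, ← mul_div_assoc, le_div_iff₀ (by positivity)]
    have h3 := hD t ht0
    calc y * Real.exp (-Real.pi * t ^ 2) * ((1 + y) * (2 + y))
        ≤ y * Real.exp (-Real.pi * t ^ 2) * (6 * (1 + t) ^ (2 * d)) := by gcongr
      _ = 6 * y * ((1 + t) ^ (2 * d) * Real.exp (-Real.pi * t ^ 2)) := by ring
      _ ≤ 6 * y * D := by gcongr
      _ = _ := by ring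
  rw [add_mul, one_mul]
  refine add_le_add ?_ ?_
  · calc ∑ k ∈ Finset.range n, (1 / 2 : ℝ) ^ k *
          Real.exp (-Real.pi * (r / (4 : ℝ) ^ (k / d : ℝ)) ^ 2)
        ≤ ∑ k ∈ Finset.range n, (1 / 2 : ℝ) ^ k := by
          refine Finset.sum_le_sum fun k _ => mul_le_of_le_one_right (by positivity) ?_
          rw [Real.exp_le_one_iff]
          nlinarith [Real.pi_pos, sq_nonneg (r / (4 : ℝ) ^ (k / d : ℝ))]
      _ ≤ 2 := sum_geometric_two_le n
  · rw [Finset.mul_sum]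
    refine (Finset.sum_le_sum fun k _ => hterm k).trans ?_
    rw [← Finset.mul_sum, Finset.sum_range_sub']
    refine mul_le_of_le_one_right (by positivity) ?_
    have h0 : φ 0 ≤ 1 := by
      rw [hφ]
      exact (div_le_one (by positivity)).2 (by linarith)
    have hn : 0 ≤ φ n := by positivity
    linarith

end Chirp

section Spread

variable {V : Type} [NormedAddCommGroup V] [InnerProductSpace ℝ V] [FiniteDimensional ℝ V]
  [MeasurableSpace V] [BorelSpace V]

theorem eLpNorm_le_of_rpow_norm_le {E : Type*} [NormedAddCommGroup E] {X : Type*}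
    [MeasurableSpace X] {μ : Measure X} {r : ℝ≥0∞} (hr0 : r ≠ 0) (hrt : r ≠ ∞) {F : X → E}
    {R : X → ℝ} (hR : Integrable R μ) (hFR : ∀ x, ‖F x‖ ^ r.toReal ≤ R x) {Y : ℝ}
    (hY : ∫ x, R x ∂μ ≤ Y) : eLpNorm F r μ ≤ ENNReal.ofReal (Y ^ (1 / r.toReal)) := by
  have hr := ENNReal.toReal_pos hr0 hrt
  have hR0 : ∀ x, 0 ≤ R x := fun x => le_trans (by positivity) (hFR x)
  have hY0 : 0 ≤ Y := (integral_nonneg hR0).trans hY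
  rw [eLpNorm_eq_lintegral_rpow_enorm_toReal hr0 hrt,
    ← ENNReal.ofReal_rpow_of_nonneg hY0 (by positivity)]
  gcongr
  refine le_trans ?_ (ENNReal.ofReal_le_ofReal hY)
  rw [ofReal_integral_eq_lintegral_ofReal hR (ae_of_all _ hR0)]
  refine lintegral_mono fun x => ?_
  rw [← ofReal_norm, ENNReal.ofReal_rpow_of_nonneg (norm_nonneg _) hr.le]
  exact ENNReal.ofReal_le_ofReal (hFR x)

theorem le_eLpNorm_of_le_rpow_norm {E : Type*} [NormedAddCommGroup E] {X : Type*}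
    [MeasurableSpace X] {μ : Measure X} {r : ℝ≥0∞} (hr0 : r ≠ 0) (hrt : r ≠ ∞) {F : X → E}
    (hF : MemLp F r μ) {R : X → ℝ} (hR : Integrable R μ) (hFR : ∀ x, R x ≤ ‖F x‖ ^ r.toReal)
    {c : ℝ} (hc0 : 0 ≤ c) (hc : c ≤ ∫ x, R x ∂μ) :
    ENNReal.ofReal (c ^ (1 / r.toReal)) ≤ eLpNorm F r μ := by
  have hr := ENNReal.toReal_pos hr0 hrt
  rw [hF.eLpNorm_eq_integral_rpow_norm hr0 hrt, one_div]
  refine ENNReal.ofReal_le_ofReal (Real.rpow_le_rpow hc0 (hc.trans ?_) (by positivity))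
  exact integral_mono hR (hF.integrable_norm_rpow hr0 hrt) hFR

theorem exists_spread_chirp {p p' : ℝ≥0∞} (hp : 2 ≤ p) (hconj : 1 / p + 1 / p' = 1)
    (hn : 0 < Module.finrank ℝ V) {α β : ℝ} (hα : 0 < α) (hβ : 0 < β)
    (hle : α ≤ Module.finrank ℝ V * (1 / 2 - (1 / p).toReal)) :
    ∃ c Y : ℝ, 0 < c ∧ 0 < Y ∧ ∀ η : ℝ, 0 < η → ∃ g : SchwartzMap V ℂ,
      eLpNorm g p volume ≤ ENNReal.ofReal η ∧
      eLpNorm (fun x => ‖x‖ ^ α * ‖g x‖) p volume ≤ ENNReal.ofReal η ∧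
      ENNReal.ofReal c ≤ eLpNorm (𝓕 (g : V → ℂ)) p' volume ∧
      eLpNorm (fun ξ => ‖ξ‖ ^ β * ‖𝓕 (g : V → ℂ) ξ‖) p' volume ≤ ENNReal.ofReal Y := by
  obtain ⟨hq1', hq2'⟩ := one_le_conj_le_two hp hconj
  have hp'0 : p' ≠ 0 := (zero_lt_one.trans_le hq1').ne'
  have hp't : p' ≠ ∞ := (hq2'.trans_lt ENNReal.ofNat_lt_top).ne
  have hq1 : 1 ≤ p'.toReal := by simpa using ENNReal.toReal_mono hp't hq1'
  have hq2 : p'.toReal ≤ 2 := by simpa using ENNReal.toReal_mono ENNReal.ofNat_ne_top hq2'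
  have ha0 : 0 ≤ (1 / p).toReal := ENNReal.toReal_nonneg
  set d := Module.finrank ℝ V with hd
  set a := (1 / p).toReal with ha
  set q := p'.toReal with hq
  have hdR : (0 : ℝ) < d := by exact_mod_cast hn
  have hθ : 0 < 1 - 2 * a := by
    have := (mul_pos_iff_of_pos_left hdR).1 (hα.trans_le hle)
    linarith
  set w : V → ℝ := fun ξ => Real.exp (-Real.pi * ‖ξ‖ ^ 2) with hw
  have hw0 : ∀ ξ, 0 < w ξ := fun ξ => Real.exp_pos _
  set v : V → ℝ := fun ξ => ‖ξ‖ ^ β * w ξ with hv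
  have hv0 : ∀ ξ, 0 ≤ v ξ := fun ξ => mul_nonneg (by positivity) (hw0 ξ).le
  have hu : Integrable (fun ξ => w ξ ^ q) volume := by
    refine ((memLp_exp_neg_mul_sq (V := V) Real.pi_pos p').integrable_norm_rpow
      hp'0 hp't).congr (ae_of_all _ fun ξ => ?_)
    beta_reduce
    rw [Real.norm_of_nonneg (hw0 ξ).le]
  have hvq : Integrable (fun ξ => v ξ ^ q) volume := by
    refine ((memLp_rpow_mul_exp_neg_mul_sq (V := V) Real.pi_pos hβ.le p').integrable_norm_rpow
      hp'0 hp't).congr (ae_of_all _ fun ξ => ?_)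
    beta_reduce
    rw [Real.norm_of_nonneg (hv0 ξ)]
  have hw2 : Integrable (fun ξ => w ξ ^ 2) volume :=
    (memLp_exp_neg_mul_sq (V := V) Real.pi_pos 2).integrable_sq
  have hU : Integrable (fun ξ => v ξ ^ q + w ξ ^ 2) volume := hvq.add hw2
  have hu0 : ∀ ξ, 0 < w ξ ^ q := fun ξ => Real.rpow_pos_of_pos (hw0 ξ) _
  have hU0 : ∀ ξ, 0 < v ξ ^ q + w ξ ^ 2 := fun ξ =>
    add_pos_of_nonneg_of_pos (Real.rpow_nonneg (hv0 ξ) _) (pow_pos (hw0 ξ) _)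
  have hpos : ∀ F : V → ℝ, (∀ ξ, 0 < F ξ) → Integrable F volume → 0 < ∫ ξ, F ξ := by
    intro F hF hFi
    rw [integral_pos_iff_support_of_nonneg (fun ξ => (hF ξ).le) hFi,
      show Function.support F = Set.univ from Set.eq_univ_of_forall fun ξ => (hF ξ).ne']
    exact Measure.measure_univ_pos.2 (NeZero.ne _)
  have hI := hpos _ hu0 hu
  have hJ := hpos _ hU0 hU
  set I := ∫ ξ, w ξ ^ q with hIdef
  set J := ∫ ξ, (v ξ ^ q + w ξ ^ 2) with hJdef
  obtain ⟨K, hK0, hK⟩ := exists_weighted_sum_chirp_le hn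
  refine ⟨(I / 4) ^ (1 / q), (12 * J) ^ (1 / q), by positivity, by positivity, fun η hη => ?_⟩
  obtain ⟨n, hn0, hnη⟩ : ∃ n : ℕ, 0 < n ∧
      ((√n)⁻¹ * K) ^ (1 - 2 * a) * ((12 * J) ^ (1 / (2 : ℝ))) ^ (2 * a) ≤ η := by
    have h1 : Filter.Tendsto (fun n : ℕ => (√(n : ℝ))⁻¹) Filter.atTop (nhds 0) :=
      tendsto_inv_atTop_zero.comp (Real.tendsto_sqrt_atTop.comp tendsto_natCast_atTop_atTop)
    have h2 := (((h1.mul_const K).rpow_const (p := 1 - 2 * a) (Or.inr hθ.le)).mul_const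
      (((12 * J) ^ (1 / (2 : ℝ))) ^ (2 * a)))
    rw [zero_mul, Real.zero_rpow hθ.ne', zero_mul] at h2
    obtain ⟨n, h3, h4⟩ :=
      ((h2.eventually_le_const hη).and (Filter.eventually_gt_atTop 0)).exists
    exact ⟨n, h4, h3⟩
  have hL : ∀ k : Fin n, 1 ≤ (4 : ℝ) ^ (k / d : ℝ) := fun k =>
    Real.one_le_rpow (by norm_num) (by positivity)
  set b : Fin n → ℂ :=
    fun k => Real.pi * (1 + √(((4 : ℝ) ^ (k / d : ℝ)) ^ 2 - 1) * Complex.I) with hb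
  have hbre : ∀ k, (b k).re = Real.pi := fun k => by simp [hb]
  have hb0 : ∀ k, 0 < (b k).re := fun k => by rw [hbre]; exact Real.pi_pos
  set F : Fin n → SchwartzMap V ℂ := fun k => gaussianSchwartz V (b k) (hb0 k) with hF
  have hFw : ∀ k ξ, ‖F k ξ‖ = w ξ := fun k ξ => by
    rw [hF]
    beta_reduce
    rw [norm_gaussianSchwartz, hbre]
  obtain ⟨ε, hε⟩ := exists_sign_choice (μ := (volume : Measure V)) hn0
    (z := fun k ξ => F k ξ / (w ξ : ℂ))
    (fun k => (F k).continuous.measurable.div (by fun_prop))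
    (fun k ξ => by
      rw [norm_div, hFw, Complex.norm_real, Real.norm_of_nonneg (hw0 ξ).le, div_self (hw0 ξ).ne'])
    hu hU (fun ξ => (hu0 ξ).le) (fun ξ => (hU0 ξ).le) hI hJ
  set Q : V → ℝ := fun ξ => ‖((√n)⁻¹ : ℂ) * ∑ k, boolSign (ε k) * (F k ξ / (w ξ : ℂ))‖ with hQ
  obtain ⟨hi1, hi2, hlow, hup⟩ := hε Q fun ξ => rfl
  have hQ0 : ∀ ξ, 0 ≤ Q ξ := fun ξ => norm_nonneg _
  set S : SchwartzMap V ℂ := ((√n)⁻¹ : ℂ) • ∑ k, boolSign (ε k) • F k with hS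
  have hSx : ∀ ξ, S ξ = ((√n)⁻¹ : ℂ) * ∑ k, boolSign (ε k) * F k ξ := fun ξ => by
    rw [hS, smul_apply, smul_eq_mul]
    congr 1
    simp
  have hSw : ∀ ξ, ‖S ξ‖ = w ξ * Q ξ := fun ξ => by
    have hwc : (w ξ : ℂ) ≠ 0 := by exact_mod_cast (hw0 ξ).ne'
    rw [← Real.norm_of_nonneg (hw0 ξ).le, ← Complex.norm_real, hQ, ← norm_mul, hSx,
      mul_left_comm]
    congr 2
    rw [Finset.mul_sum]
    refine Finset.sum_congr rfl fun k _ => ?_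
    field_simp
  set g : SchwartzMap V ℂ := 𝓕⁻ S with hg
  have hgS : 𝓕 (g : V → ℂ) = S := by
    rw [← SchwartzMap.fourier_coe, hg, FourierTransform.fourier_fourierInv_eq]
  have hgx : ∀ x, (1 + ‖x‖ ^ (d / 2 : ℝ)) * ‖g x‖ ≤ (√n)⁻¹ * K := fun x => by
    have h1 : g x = ((√n)⁻¹ : ℂ) * ∑ k, boolSign (ε k) * 𝓕 (F k : V → ℂ) (-x) := by
      have h3 : 𝓕 S = ((√n)⁻¹ : ℂ) • ∑ k, boolSign (ε k) • 𝓕 (F k) := by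
        have h4 : ∀ T : SchwartzMap V ℂ, 𝓕 T = FourierTransform.fourierCLM ℂ _ T := fun _ => rfl
        rw [h4, hS, map_smul, map_sum]
        simp only [map_smul, h4]
      rw [hg, SchwartzMap.fourierInv_coe, Real.fourierInv_eq_fourier_neg,
        ← SchwartzMap.fourier_coe, h3, smul_apply, smul_eq_mul]
      congr 1
      simp [SchwartzMap.fourier_coe]
    have h2 : ‖g x‖ ≤ (√n)⁻¹ * ∑ k : Fin n, ((4 : ℝ) ^ (k / d : ℝ)) ^ (-(d / 2 : ℝ)) *
        Real.exp (-Real.pi * (‖x‖ / (4 : ℝ) ^ (k / d : ℝ)) ^ 2) := by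
      rw [h1, norm_mul, norm_inv, Complex.norm_real, Real.norm_of_nonneg (Real.sqrt_nonneg _)]
      gcongr
      refine (norm_sum_le _ _).trans (Finset.sum_le_sum fun k _ => ?_)
      have h3 : ‖boolSign (ε k)‖ = 1 := by cases ε k <;> simp [boolSign]
      rw [norm_mul, h3, one_mul, norm_fourier_chirp (hL k) rfl (hb0 k), norm_neg]
    calc _ ≤ (1 + ‖x‖ ^ (d / 2 : ℝ)) * ((√n)⁻¹ * ∑ k : Fin n,
          ((4 : ℝ) ^ (k / d : ℝ)) ^ (-(d / 2 : ℝ)) *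
          Real.exp (-Real.pi * (‖x‖ / (4 : ℝ) ^ (k / d : ℝ)) ^ 2)) := by gcongr
      _ ≤ _ := by
        rw [mul_left_comm]
        gcongr
        exact hK n _ (norm_nonneg x)
  have hg2 : eLpNorm g 2 volume ≤ ENNReal.ofReal ((12 * J) ^ (1 / (2 : ℝ))) := by
    rw [← eLpNorm_fourier_two (g.memLp 1 volume |> memLp_one_iff_integrable.1) (g.memLp 2 volume),
      hgS]
    have := eLpNorm_le_of_rpow_norm_le (F := S) two_ne_zero ENNReal.ofNat_ne_top hi2
      (fun ξ => ?_) hup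
    · simpa using this
    · rw [hSw, ENNReal.toReal_ofNat, Real.rpow_two]
      have := Real.rpow_nonneg (hv0 ξ) q
      nlinarith [sq_nonneg (w ξ), sq_nonneg (Q ξ), mul_nonneg this (sq_nonneg (Q ξ))]
  have hweight : ∀ ω : V → ℝ, (∀ x, 0 ≤ ω x) →
      (∀ x, ω x ≤ (1 + ‖x‖ ^ (d / 2 : ℝ)) ^ (1 - 2 * a)) →
      eLpNorm (fun x => ω x * ‖g x‖) p volume ≤ ENNReal.ofReal η := fun ω hω hωW => by
    refine (eLpNorm_weight_le_of_sup_bound hp (by positivity) (fun x => by positivity) hω hωW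
      hgx).trans ?_
    refine le_trans ?_ (ENNReal.ofReal_le_ofReal hnη)
    rw [ENNReal.ofReal_mul (by positivity),
      ← ENNReal.ofReal_rpow_of_nonneg (p := 2 * a) (by positivity) (by positivity)]
    gcongr
  refine ⟨g, ?_, ?_, ?_, ?_⟩
  · have := hweight (fun _ => 1) (fun _ => zero_le_one) fun x =>
      Real.one_le_rpow (le_add_of_nonneg_right (by positivity)) hθ.le
    simpa using this
  · refine hweight _ (fun x => by positivity) fun x => ?_
    rcases le_total ‖x‖ 1 with h | h
    · exact (Real.rpow_le_one (norm_nonneg x) h hα.le).trans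
        (Real.one_le_rpow (le_add_of_nonneg_right (by positivity)) hθ.le)
    · calc ‖x‖ ^ α ≤ ‖x‖ ^ ((d / 2 : ℝ) * (1 - 2 * a)) :=
            Real.rpow_le_rpow_of_exponent_le h (hle.trans_eq (by ring))
        _ = (‖x‖ ^ (d / 2 : ℝ)) ^ (1 - 2 * a) := Real.rpow_mul (norm_nonneg x) _ _
        _ ≤ _ := Real.rpow_le_rpow (by positivity) (by linarith) hθ.le
  · rw [hgS]
    refine le_eLpNorm_of_le_rpow_norm hp'0 hp't (S.memLp p' volume) hi1 (fun ξ => ?_)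
      (by positivity) hlow
    rw [hSw, Real.mul_rpow (hw0 ξ).le (hQ0 ξ)]
    exact mul_le_mul_of_nonneg_left (sq_sub_le_rpow (hQ0 ξ) hq1 hq2) (hu0 ξ).le
  · rw [hgS]
    refine eLpNorm_le_of_rpow_norm_le hp'0 hp't hi2 (fun ξ => ?_) hup
    rw [hSw, ← mul_assoc, Real.norm_of_nonneg (mul_nonneg (hv0 ξ) (hQ0 ξ)),
      Real.mul_rpow (hv0 ξ) (hQ0 ξ)]
    have h1 := rpow_le_one_add_sq (hQ0 ξ) hq1 hq2
    have h2 := Real.rpow_nonneg (hv0 ξ) q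
    have h3 := Real.rpow_nonneg (hQ0 ξ) q
    gcongr
    nlinarith [sq_nonneg (w ξ)]

end Spread

section Necessity

variable {V : Type} [NormedAddCommGroup V] [InnerProductSpace ℝ V] [FiniteDimensional ℝ V]
  [MeasurableSpace V] [BorelSpace V]

theorem eLpNorm_weight_add_le {E : Type*} [NormedAddCommGroup E] {X : Type*}
    [MeasurableSpace X] {μ : Measure X} {r : ℝ≥0∞} (hr : 1 ≤ r) {ω : X → ℝ}
    (hω : AEStronglyMeasurable ω μ) (hω0 : ∀ x, 0 ≤ ω x) {F G : X → E}
    (hF : AEStronglyMeasurable F μ) (hG : AEStronglyMeasurable G μ) :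
    eLpNorm (fun x => ω x * ‖F x + G x‖) r μ ≤
      eLpNorm (fun x => ω x * ‖F x‖) r μ + eLpNorm (fun x => ω x * ‖G x‖) r μ := by
  refine le_trans (eLpNorm_mono_real fun x => ?_)
    (eLpNorm_add_le (hω.mul hF.norm) (hω.mul hG.norm) hr)
  rw [Real.norm_of_nonneg (mul_nonneg (hω0 x) (norm_nonneg _)), Pi.add_apply]
  exact (mul_le_mul_of_nonneg_left (norm_add_le _ _) (hω0 x)).trans_eq (mul_add _ _ _)

theorem ofReal_sub_le_eLpNorm_add {E : Type*} [NormedAddCommGroup E] {X : Type*}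
    [MeasurableSpace X] {μ : Measure X} {r : ℝ≥0∞} (hr : 1 ≤ r) {F G : X → E}
    (hF : AEStronglyMeasurable F μ) (hG : AEStronglyMeasurable G μ) {s t : ℝ} (ht : 0 ≤ t)
    (hFt : eLpNorm F r μ ≤ ENNReal.ofReal t) (hGs : ENNReal.ofReal s ≤ eLpNorm G r μ) :
    ENNReal.ofReal (s - t) ≤ eLpNorm (F + G) r μ := by
  rw [ENNReal.ofReal_sub _ ht, tsub_le_iff_right]
  calc ENNReal.ofReal s ≤ eLpNorm (F + G - F) r μ := by rwa [add_sub_cancel_left]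
    _ ≤ eLpNorm (F + G) r μ + eLpNorm F r μ := eLpNorm_sub_le (hF.add hG) hF hr
    _ ≤ _ := by gcongr

variable {p p' : ℝ≥0∞} {α β C : ℝ}

theorem exponent_eq_of_heisenberg (hp : 2 ≤ p) (hconj : 1 / p + 1 / p' = 1)
    (hn : 0 < Module.finrank ℝ V) (hα : 0 < α) (hβ : 0 < β) (hC : 0 < C)
    (h : ∀ f : SchwartzMap V ℂ,
      eLpNorm f p volume * eLpNorm (𝓕 (f : V → ℂ)) p' volume ≤ ENNReal.ofReal C *
        (eLpNorm (fun x => ‖x‖ ^ α * ‖f x‖) p volume *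
          eLpNorm (fun ξ => ‖ξ‖ ^ β * ‖𝓕 (f : V → ℂ) ξ‖) p' volume)) : α = β := by
  obtain ⟨N, M, A, B, hN, hM, hA, hB, hcon⟩ := exists_concentrated_gaussian hp hconj hn hα hβ
  have key : ∀ δ : ℝ, 0 < δ → N * M ≤ C * A * B * δ ^ (α - β) := fun δ hδ => by
    obtain ⟨f, h1, h2, h3, h4⟩ := hcon δ 1 hδ one_pos
    have h5 := h f
    rw [h1, h2, h3, h4, ← ENNReal.ofReal_mul (by positivity), ← ENNReal.ofReal_mul (by positivity),
      ← ENNReal.ofReal_mul hC.le, ENNReal.ofReal_le_ofReal_iff (by positivity)] at h5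
    rw [sub_eq_add_neg, Real.rpow_add hδ]
    linarith
  by_contra hne
  have hsub : α - β ≠ 0 := sub_ne_zero.2 hne
  have h0 := key ((N * M / (2 * (C * A * B))) ^ (α - β)⁻¹) (by positivity)
  rw [Real.rpow_inv_rpow (by positivity) hsub] at h0
  have h1 : C * A * B * (N * M / (2 * (C * A * B))) = N * M / 2 := by field_simp
  have h2 : 0 < N * M := by positivity
  linarith

theorem lt_exponent_of_heisenberg (hp : 2 ≤ p) (hconj : 1 / p + 1 / p' = 1)
    (hn : 0 < Module.finrank ℝ V) (hα : 0 < α) (hβ : 0 < β) (hC : 0 < C) (hαβ : α = β)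
    (h : ∀ f : SchwartzMap V ℂ,
      eLpNorm f p volume * eLpNorm (𝓕 (f : V → ℂ)) p' volume ≤ ENNReal.ofReal C *
        (eLpNorm (fun x => ‖x‖ ^ α * ‖f x‖) p volume *
          eLpNorm (fun ξ => ‖ξ‖ ^ β * ‖𝓕 (f : V → ℂ) ξ‖) p' volume)) :
    Module.finrank ℝ V * (1 / 2 - (1 / p).toReal) < α := by
  by_contra! hle
  obtain ⟨N, M, A, B, hN, hM, hA, hB, hcon⟩ := exists_concentrated_gaussian hp hconj hn hα hβ
  obtain ⟨c, Y, hc, hY, hspread⟩ := exists_spread_chirp hp hconj hn hα hβ hle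
  have hp1 : 1 ≤ p := one_le_two.trans hp
  have hp'1 := (one_le_conj_le_two hp hconj).1
  have key : ∀ τ η : ℝ, 0 < τ → 0 < η → η ≤ τ * N → τ * M ≤ c →
      (τ * N - η) * (c - τ * M) ≤ C * ((η + τ ^ 2 * A) * (Y + B)) := by
    intro τ η hτ hη hηN hτM
    obtain ⟨f, hf1, hf2, hf3, hf4⟩ := hcon (τ ^ α⁻¹) τ (by positivity) hτ
    obtain ⟨g, hg1, hg2, hg3, hg4⟩ := hspread η hη
    rw [Real.rpow_inv_rpow hτ.le hα.ne'] at hf3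
    have hτβ : τ * (τ ^ α⁻¹) ^ (-β) = 1 := by
      rw [Real.rpow_neg (by positivity), ← hαβ, Real.rpow_inv_rpow hτ.le hα.ne',
        mul_inv_cancel₀ hτ.ne']
    rw [hτβ, one_mul] at hf4
    have hfg : 𝓕 ((g + f : SchwartzMap V ℂ) : V → ℂ) = 𝓕 (g : V → ℂ) + 𝓕 (f : V → ℂ) := by
      rw [← SchwartzMap.fourier_coe, ← SchwartzMap.fourier_coe, ← SchwartzMap.fourier_coe,
        FourierTransform.fourier_add]
      rfl
    have hcf : ∀ u : SchwartzMap V ℂ, AEStronglyMeasurable (𝓕 (u : V → ℂ)) volume := fun u => by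
      rw [← SchwartzMap.fourier_coe]
      exact (𝓕 u).continuous.aestronglyMeasurable
    have hc' : ∀ u : SchwartzMap V ℂ, AEStronglyMeasurable u volume := fun u =>
      u.continuous.aestronglyMeasurable
    have hwm : ∀ s : ℝ, AEStronglyMeasurable (fun x : V => ‖x‖ ^ s) volume := fun s =>
      (measurable_norm.pow_const s).aestronglyMeasurable
    have h1 : ENNReal.ofReal (τ * N - η) ≤ eLpNorm (g + f : SchwartzMap V ℂ) p volume :=
      ofReal_sub_le_eLpNorm_add hp1 (hc' g) (hc' f) hη.le hg1 hf1.ge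
    have h2 : ENNReal.ofReal (c - τ * M) ≤
        eLpNorm (𝓕 ((g + f : SchwartzMap V ℂ) : V → ℂ)) p' volume := by
      rw [hfg, add_comm]
      exact ofReal_sub_le_eLpNorm_add hp'1 (hcf f) (hcf g) (by positivity) hf2.le hg3
    have h3 : eLpNorm (fun x => ‖x‖ ^ α * ‖(g + f : SchwartzMap V ℂ) x‖) p volume ≤
        ENNReal.ofReal (η + τ ^ 2 * A) := by
      rw [ENNReal.ofReal_add hη.le (by positivity), sq, ← hf3]
      exact (eLpNorm_weight_add_le hp1 (hwm α) (fun x => by positivity) (hc' g) (hc' f)).trans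
        (add_le_add_left hg2 _)
    have h4 : eLpNorm (fun ξ => ‖ξ‖ ^ β * ‖𝓕 ((g + f : SchwartzMap V ℂ) : V → ℂ) ξ‖) p' volume ≤
        ENNReal.ofReal (Y + B) := by
      rw [ENNReal.ofReal_add hY.le hB.le, ← hf4, hfg]
      exact (eLpNorm_weight_add_le hp'1 (hwm β) (fun x => by positivity) (hcf g) (hcf f)).trans
        (add_le_add_left hg4 _)
    have h5 := (mul_le_mul' h1 h2).trans ((h (g + f)).trans
      (mul_le_mul_right (mul_le_mul' h3 h4) _))
    rwa [← ENNReal.ofReal_mul (by linarith), ← ENNReal.ofReal_mul (by positivity),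
      ← ENNReal.ofReal_mul hC.le, ENNReal.ofReal_le_ofReal_iff (by positivity)] at h5
  set τ : ℝ := min (c / (2 * M)) (N * c / (16 * (C * A * (Y + B)))) with hτ
  have hτ0 : 0 < τ := by positivity
  have hτ1 : τ * M ≤ c / 2 := by
    calc τ * M ≤ c / (2 * M) * M := by gcongr; exact min_le_left _ _
      _ = c / 2 := by field_simp
  have hτ2 : τ * (C * A * (Y + B)) ≤ N * c / 16 := by
    calc τ * (C * A * (Y + B)) ≤ N * c / (16 * (C * A * (Y + B))) * (C * A * (Y + B)) := by
          gcongr; exact min_le_right _ _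
      _ = N * c / 16 := by field_simp
  set η : ℝ := min (τ * N / 2) (τ ^ 2 * A) with hη
  have hη0 : 0 < η := by positivity
  have hη1 : η ≤ τ * N / 2 := min_le_left _ _
  have hη2 : η ≤ τ ^ 2 * A := min_le_right _ _
  have hτN : 0 < τ * N := by positivity
  have h0 := key τ η hτ0 hη0 (by linarith) (by linarith)
  have h1 : τ * N / 2 * (c / 2) ≤ (τ * N - η) * (c - τ * M) := by
    gcongr <;> linarith
  have h2 : C * ((η + τ ^ 2 * A) * (Y + B)) ≤ C * ((τ ^ 2 * A + τ ^ 2 * A) * (Y + B)) := by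
    gcongr
  have h3 : τ * (τ * (C * A * (Y + B))) ≤ τ * (N * c / 16) := by gcongr
  have h4 : 0 < τ * N * c := by positivity
  nlinarith

end Necessity

/-- The symmetric Heisenberg–Pauli–Weyl uncertainty principle with power weights:
`‖f‖_p ‖f̂‖_{p'} ≲ ‖|x|^α f‖_p ‖|ξ|^β f̂‖_{p'}` holds iff `α = β > d(1/2 − 1/p)`. -/
theorem heisenberg_symmetric_characterization
    (d : ℕ) (hd : 1 ≤ d) (p p' : ℝ≥0∞) (hp : 2 ≤ p) (hconj : 1/p + 1/p' = 1)
    (α β : ℝ) (hα : 0 < α) (hβ : 0 < β) :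
    (∃ C : ℝ, 0 < C ∧
      ∀ f : SchwartzMap (EuclideanSpace ℝ (Fin d)) ℂ,
        eLpNorm (⇑f) p volume * eLpNorm (𝓕 (⇑f)) p' volume ≤ ENNReal.ofReal C *
          (eLpNorm (fun x => ‖x‖ ^ α * ‖f x‖) p volume *
            eLpNorm (fun ξ => ‖ξ‖ ^ β * ‖𝓕 (⇑f) ξ‖) p' volume)) ↔
    (α = β ∧ (d : ℝ) * (1/2 - (1/p).toReal) < α) := by
  have hn : Module.finrank ℝ (EuclideanSpace ℝ (Fin d)) = d := finrank_euclideanSpace_fin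
  have hn0 : 0 < Module.finrank ℝ (EuclideanSpace ℝ (Fin d)) := by rwa [hn]
  constructor
  · rintro ⟨C, hC, h⟩
    have hαβ := exponent_eq_of_heisenberg hp hconj hn0 hα hβ hC h
    refine ⟨hαβ, ?_⟩
    have := lt_exponent_of_heisenberg hp hconj hn0 hα hβ hC hαβ h
    rwa [hn] at this
  · rintro ⟨rfl, hlt⟩
    exact heisenberg_of_lt hp hconj hα hn0 (by rwa [hn])
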